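/- Let G be a 2-connected bipartite graph with bipartition (A, B), where |A| ≥ |B|, every vertex of A has degree at least k, and every vertex of B has degree at least l. Then G contains a cycle of length at least 2·min(|B|, k+l−1, 2k−2). Moreover, if k = l and |A| = |B|, then G contains a cycle of length at least 2·min(|B|, 2k−1). -/

import Mathlib

/-- The degree of a vertex (classical version, no decidability assumptions). -/
noncomputable def deg {V : Type*} [Fintype V] (G : SimpleGraph V) (v : V) : ℕ := by
  classical exact G.degree v

/-- `G` is `k`-connected: it has more than `k` vertices and removing any set of fewer
than `k` vertices leaves a connected graph. -/
def KConnected {V : Type*} (k : ℕ) (G : SimpleGraph V) : Prop :=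
  k < Nat.card V ∧ ∀ s : Set V, s.Finite → s.ncard < k → (G.induce sᶜ).Connected

namespace BipartiteCycle

section

variable {V : Type*} {G : SimpleGraph V}

/-- `l` lists the vertices of a path of `G` from `a` to `b`. -/
structure Pth (G : SimpleGraph V) (l : List V) (a b : V) : Prop where
  chain : l.IsChain G.Adj
  nodup : l.Nodup
  head : l.head? = some a
  last : l.getLast? = some b

/-- `l` lists the vertices of a closed path of `G` in cyclic order. -/
def Cyc (G : SimpleGraph V) (l : List V) : Prop :=
  ∃ a b, Pth G l a b ∧ G.Adj b a

/-- `G` has a cycle of length at least `2 * m`. -/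
def HasCyc (G : SimpleGraph V) (m : ℕ) : Prop :=
  ∃ (v : V) (w : G.Walk v v), w.IsCycle ∧ 2 * m ≤ w.length

lemma HasCyc.mono {m n : ℕ} (h : HasCyc G n) (hmn : m ≤ n) : HasCyc G m := by
  obtain ⟨v, w, hw, hl⟩ := h
  exact ⟨v, w, hw, by omega⟩

namespace Pth

lemma singleton (a : V) : Pth G [a] a a := ⟨by simp, by simp, by simp, by simp⟩

lemma ne_nil {l : List V} {a b : V} (h : Pth G l a b) : l ≠ [] := by
  rintro rfl
  simpa using h.head

lemma head_mem {l : List V} {a b : V} (h : Pth G l a b) : a ∈ l :=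
  List.mem_of_mem_head? h.head

lemma last_mem {l : List V} {a b : V} (h : Pth G l a b) : b ∈ l :=
  List.mem_of_mem_getLast? h.last

lemma reverse {l : List V} {a b : V} (h : Pth G l a b) : Pth G l.reverse b a := by
  refine ⟨?_, by simpa using h.nodup, by simpa using h.last, by simpa using h.head⟩
  rw [List.isChain_reverse]
  exact h.chain.imp fun _ _ hab => hab.symm

lemma append {l m : List V} {a b c d : V} (h : Pth G l a b) (h' : Pth G m c d)
    (hbc : G.Adj b c) (hd : ∀ v ∈ l, v ∉ m) : Pth G (l ++ m) a d := by
  refine ⟨?_, ?_, by simp [h.head], by simp [h'.last]⟩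
  · rw [List.isChain_append]
    refine ⟨h.chain, h'.chain, ?_⟩
    intro x hx y hy
    rw [h.last] at hx
    rw [h'.head] at hy
    simp only [Option.mem_def, Option.some.injEq] at hx hy
    subst hx hy
    exact hbc
  · exact List.Nodup.append h.nodup h'.nodup (fun v hv hv' => hd v hv hv')

lemma cons {l : List V} {a b c : V} (h : Pth G l a b) (hc : G.Adj c a) (hd : c ∉ l) :
    Pth G (c :: l) c b :=
  (singleton c).append h hc (by simpa using hd)

lemma concat {l : List V} {a b c : V} (h : Pth G l a b) (hc : G.Adj b c) (hd : c ∉ l) :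
    Pth G (l ++ [c]) a c :=
  h.append (singleton c) hc (by
    intro v hv hv'
    simp only [List.mem_singleton] at hv'
    exact hd (hv' ▸ hv))

lemma right_of_append {l m : List V} {a b v : V} (h : Pth G (l ++ v :: m) a b) :
    Pth G (v :: m) v b := by
  refine ⟨?_, ?_, by simp, ?_⟩
  · exact (List.isChain_append.1 h.chain).2.1
  · exact h.nodup.of_append_right
  · have := h.last
    rwa [List.getLast?_append_of_ne_nil _ (by simp)] at this

lemma left_of_append {l m : List V} {a b v : V} (h : Pth G (l ++ v :: m) a b) :
    Pth G (l ++ [v]) a v := by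
  have h1 : Pth G (m.reverse ++ v :: l.reverse) b a := by simpa using h.reverse
  simpa using h1.right_of_append.reverse

/-- Two paths sharing exactly one endpoint concatenate to a path. -/
lemma trans {l m : List V} {a b c : V} (h : Pth G l a b) (h' : Pth G m b c)
    (hd : ∀ v ∈ l, v ∈ m → v = b) : ∃ p, Pth G p a c ∧ ∀ v, v ∈ p ↔ v ∈ l ∨ v ∈ m := by
  obtain ⟨m', rfl⟩ : ∃ m', m = b :: m' := by
    cases m with
    | nil => simpa using h'.head
    | cons x m' => exact ⟨m', by simpa using h'.head⟩
  cases m' with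
  | nil =>
    have : b = c := by simpa using h'.last
    subst this
    refine ⟨l, h, fun v => ?_⟩
    have := h.last_mem
    constructor
    · exact Or.inl
    · rintro (hv | hv)
      · exact hv
      · simp only [List.mem_singleton] at hv
        exact hv ▸ this
  | cons x m' =>
    have hx : Pth G (x :: m') x c := by
      have : Pth G ([b] ++ x :: m') b c := h'
      exact this.right_of_append
    have hbx : G.Adj b x := by
      have := h'.chain
      simp only [List.isChain_cons_cons] at this
      exact this.1
    have hbn : b ∉ x :: m' := (List.nodup_cons.1 h'.nodup).1
    refine ⟨l ++ x :: m', h.append hx hbx ?_, fun v => ?_⟩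
    · intro v hv hv'
      have := hd v hv (List.mem_cons_of_mem _ hv')
      exact hbn (this ▸ hv')
    · have := h.last_mem
      simp only [List.mem_append, List.mem_cons]
      constructor
      · rintro (hv | hv) <;> tauto
      · rintro (hv | rfl | hv) <;> tauto

/-- Two paths with the same two distinct ends and nothing else in common form a closed path. -/
lemma close {l m : List V} {a b : V} (h : Pth G l a b) (h' : Pth G m b a) (hab : a ≠ b)
    (hd : ∀ v ∈ l, v ∈ m → v = a ∨ v = b) : ∃ p, Cyc G p ∧ ∀ v, v ∈ p ↔ v ∈ l ∨ v ∈ m := by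
  obtain ⟨m', rfl⟩ : ∃ m', m = m' ++ [a] := by
    have := h'.last
    rw [List.getLast?_eq_some_iff] at this
    exact this
  have hne : m' ≠ [] := by
    rintro rfl
    have : a = b := by simpa using h'.head
    exact hab this
  obtain ⟨m'', c, rfl⟩ : ∃ m'' c, m' = m'' ++ [c] := by
    obtain h | ⟨x, y, h⟩ := List.eq_nil_or_concat m'
    · exact absurd h hne
    · exact ⟨x, y, by simpa using h⟩
  have hc : Pth G (m'' ++ [c]) b c := by
    have : Pth G (m'' ++ c :: [a]) b a := by simpa using h'
    exact this.left_of_append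
  have hca : G.Adj c a := by
    have := (List.isChain_append.1 h'.chain).2.2
    simpa using this
  have ha : a ∉ m'' ++ [c] := by
    have := h'.nodup
    rw [List.nodup_append] at this
    intro h
    exact this.2.2 a h a (by simp) rfl
  obtain ⟨p, hp, hpm⟩ := h.trans hc (by
    intro v hv hv'
    rcases hd v hv (by simp only [List.mem_append] at hv' ⊢; tauto) with rfl | rfl
    · exact absurd hv' ha
    · rfl)
  refine ⟨p, ⟨a, c, hp, hca⟩, fun v => ?_⟩
  rw [hpm]
  have := h.head_mem
  simp only [List.mem_append, List.mem_singleton]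
  constructor
  · rintro (hv | hv) <;> tauto
  · rintro (hv | hv | rfl) <;> tauto

end Pth

lemma Cyc.rotate_last {l : List V} (h : Cyc G l) {c : V} (hc : c ∈ l) :
    ∃ l' d, Pth G l' d c ∧ G.Adj c d ∧ l'.length = l.length ∧ ∀ v, v ∈ l' ↔ v ∈ l := by
  obtain ⟨a, b, hl, hba⟩ := h
  obtain ⟨l1, l2, rfl⟩ := List.append_of_mem hc
  have h1 := hl.left_of_append
  have h2 := hl.right_of_append
  cases l2 with
  | nil =>
    have : c = b := by simpa using h2.last
    subst this
    exact ⟨_, a, hl, hba, rfl, fun v => Iff.rfl⟩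
  | cons x l2 =>
    have h3 : Pth G (x :: l2) x b := by
      have : Pth G ((l1 ++ [c]) ++ x :: l2) a b := by simpa using hl
      exact this.right_of_append
    have hcx : G.Adj c x := by
      have := h2.chain
      simp only [List.isChain_cons_cons] at this
      exact this.1
    refine ⟨(x :: l2) ++ (l1 ++ [c]), x, h3.append h1 hba ?_, hcx, ?_, ?_⟩
    · have h5 : ((l1 ++ [c]) ++ (x :: l2)).Nodup := by simpa using hl.nodup
      intro v hv hv'
      exact (List.nodup_append.1 h5).2.2 v hv' v hv rfl
    · simp only [List.length_append, List.length_cons, List.length_nil]; omega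
    · intro v
      simp only [List.mem_append, List.mem_cons, List.not_mem_nil]
      tauto

lemma Cyc.reverse {l : List V} (h : Cyc G l) : Cyc G l.reverse := by
  obtain ⟨a, b, hl, hba⟩ := h
  exact ⟨b, a, hl.reverse, hba.symm⟩

lemma Pth.exists_walk {l : List V} : ∀ {a b : V}, Pth G l a b →
    ∃ w : G.Walk a b, w.support = l := by
  induction l with
  | nil => intro a b h; simpa using h.head
  | cons x l ih =>
    intro a b h
    have hx : x = a := by simpa using h.head
    subst hx
    cases l with
    | nil =>
      have : x = b := by simpa using h.last
      subst this
      exact ⟨SimpleGraph.Walk.nil, rfl⟩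
    | cons y l =>
      have h1 : Pth G (y :: l) y b := by
        have : Pth G ([x] ++ y :: l) x b := h
        exact this.right_of_append
      have hxy : G.Adj x y := by
        have := h.chain
        simp only [List.isChain_cons_cons] at this
        exact this.1
      obtain ⟨w, hw⟩ := ih h1
      exact ⟨SimpleGraph.Walk.cons hxy w, by simp [hw]⟩

lemma Cyc.exists_walk {l : List V} (h : Cyc G l) (h3 : 3 ≤ l.length) :
    ∃ (v : V) (w : G.Walk v v), w.IsCycle ∧ w.length = l.length := by
  obtain ⟨a, b, hl, hba⟩ := h
  obtain ⟨w, hw⟩ := hl.exists_walk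
  have hp : w.IsPath := by
    rw [SimpleGraph.Walk.isPath_def, hw]; exact hl.nodup
  have hlen : w.length + 1 = l.length := by
    rw [← hw, SimpleGraph.Walk.length_support]
  refine ⟨b, SimpleGraph.Walk.cons hba w, ?_, by simpa using hlen⟩
  rw [SimpleGraph.Walk.cons_isCycle_iff]
  refine ⟨hp, fun he => ?_⟩
  have h2 : w.length = 1 := by
    have := hp.reverse
    have hr : w.reverse.length = 1 := by
      have he' : s(b, a) ∈ w.reverse.edges := by simpa using he
      revert this he'
      generalize w.reverse = q
      intro hq he'
      cases q with
      | nil => simp at he'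
      | cons hadj q =>
        simp only [SimpleGraph.Walk.edges_cons, List.mem_cons] at he'
        rw [SimpleGraph.Walk.cons_isPath_iff] at hq
        rcases he' with he' | he'
        · rename_i x
          have hax : a = x := by
            simp only [Sym2.eq_iff, true_and] at he'
            rcases he' with h | h
            · exact h
            · exact h.2.trans h.1
          subst hax
          have := hq.1
          rw [SimpleGraph.Walk.isPath_iff_nil] at this
          simp [SimpleGraph.Walk.length_eq_zero_iff.2 this]
        · exact absurd (SimpleGraph.Walk.fst_mem_support_of_mem_edges _ he') hq.2
    simpa using hr
  omega

/-- `G` is bipartite with sides `A` and its complement. -/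
def Bip (G : SimpleGraph V) (A : Finset V) : Prop := ∀ u v, G.Adj u v → (u ∈ A ↔ v ∉ A)

lemma Cyc.hasCyc_of_length {l : List V} (h : Cyc G l) {m : ℕ} (hm : 2 ≤ m)
    (hl : 2 * m ≤ l.length) : HasCyc G m := by
  obtain ⟨v, w, hw, hl'⟩ := h.exists_walk (by omega)
  exact ⟨v, w, hw, by omega⟩

variable [DecidableEq V]

lemma Pth.count {A : Finset V} (hA : Bip G A) {l : List V} : ∀ {a b : V}, Pth G l a b →
    2 * (l.filter (· ∈ A)).length + (if a ∈ A then 0 else 1) + (if b ∈ A then 0 else 1)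
      = l.length + 1 := by
  induction l with
  | nil => intro a b h; simpa using h.head
  | cons x l ih =>
    intro a b h
    have hx : x = a := by simpa using h.head
    subst hx
    cases l with
    | nil =>
      have : x = b := by simpa using h.last
      subst this
      by_cases hx : x ∈ A <;> simp [hx]
    | cons y l =>
      have h1 : Pth G (y :: l) y b := by
        have : Pth G ([x] ++ y :: l) x b := h
        exact this.right_of_append
      have hxy : G.Adj x y := by
        have := h.chain
        simp only [List.isChain_cons_cons] at this
        exact this.1
      have := ih h1
      have h2 := hA _ _ hxy
      rw [List.filter_cons, List.length_cons (as := y :: l)]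
      by_cases hx : x ∈ A
      · have hy := h2.1 hx
        simp only [hx, hy, decide_true, if_true, if_false, List.length_cons] at this ⊢
        omega
      · have hy : y ∈ A := by tauto
        simp only [hx, hy, decide_false, if_true, if_false] at this ⊢
        simp only [Bool.false_eq_true, if_false]
        omega

lemma Cyc.count {A : Finset V} (hA : Bip G A) {l : List V} (h : Cyc G l) :
    2 * (l.filter (· ∈ A)).length = l.length := by
  obtain ⟨a, b, hl, hba⟩ := h
  have := hl.count hA
  have h2 := hA _ _ hba
  by_cases hb : b ∈ A
  · have : a ∉ A := h2.1 hb
    simp_all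
  · have : a ∈ A := by tauto
    simp_all

lemma card_le_filter {A S : Finset V} {l : List V} (hS : S ⊆ A) (hl : ∀ v ∈ S, v ∈ l) :
    S.card ≤ (l.filter (· ∈ A)).length := by
  calc S.card ≤ (l.filter (· ∈ A)).toFinset.card := by
        apply Finset.card_le_card
        intro v hv
        simp [hl v hv, hS hv]
    _ ≤ _ := List.toFinset_card_le _

/-- A closed path containing many vertices of one side is a long cycle. -/
lemma Cyc.hasCyc {A : Finset V} (hA : Bip G A) {l : List V} (h : Cyc G l) {S : Finset V}
    (hS : S ⊆ A) (hl : ∀ v ∈ S, v ∈ l) {m : ℕ} (hm : 2 ≤ m) (hmS : m ≤ S.card) :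
    HasCyc G m := by
  have h1 := card_le_filter hS hl
  have h2 := h.count hA
  exact h.hasCyc_of_length hm (by omega)

lemma Bip.compl [Fintype V] {A : Finset V} (hA : Bip G A) : Bip G Aᶜ := by
  intro u v h
  have := hA u v h
  simp only [Finset.mem_compl]
  tauto

end

section

variable {V : Type*} {G : SimpleGraph V}

/-- Any two vertices are joined by a path avoiding any given third vertex. -/
def Conn2 (G : SimpleGraph V) : Prop :=
  ∀ v a b, a ≠ v → b ≠ v → ∃ l, Pth G l a b ∧ v ∉ l

lemma Conn2.exists_pth [Finite V] (hG : Conn2 G) (hV : 2 < Nat.card V) (a b : V) :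
    ∃ l, Pth G l a b := by
  classical
  have := Fintype.ofFinite V
  obtain ⟨v, hv⟩ : ∃ v, v ∉ ({a, b} : Finset V) := by
    by_contra! h
    have h1 : Finset.univ ⊆ ({a, b} : Finset V) := fun v _ => h v
    have h2 := Finset.card_le_card h1
    have h3 : ({a, b} : Finset V).card ≤ 2 := Finset.card_le_two
    rw [Finset.card_univ, ← Nat.card_eq_fintype_card] at h2
    omega
  simp only [Finset.mem_insert, Finset.mem_singleton, not_or] at hv
  obtain ⟨l, hl, -⟩ := hG v a b (Ne.symm hv.1) (Ne.symm hv.2)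
  exact ⟨l, hl⟩

lemma Pth.exists_minimal {S Y : Set V} : ∀ (n : ℕ) {l : List V} {a b : V}, l.length = n →
    Pth G l a b → a ∈ S → b ∈ Y → ∃ l' a' b', Pth G l' a' b' ∧ a' ∈ S ∧ b' ∈ Y ∧
      (∀ v ∈ l', v ∈ l) ∧ (∀ v ∈ l', v ∈ S → v = a') ∧ (∀ v ∈ l', v ∈ Y → v = b') := by
  intro n
  induction n using Nat.strong_induction_on with
  | _ n ih =>
  intro l a b hn hl ha hb
  by_cases h1 : ∃ v ∈ l, v ∈ S ∧ v ≠ a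
  · obtain ⟨v, hv, hvS, hva⟩ := h1
    obtain ⟨p, r, rfl⟩ := List.append_of_mem hv
    have hp : p ≠ [] := by
      rintro rfl
      exact hva (by simpa using hl.head)
    have hp' := List.length_pos_of_ne_nil hp
    simp only [List.length_append] at hn
    obtain ⟨l', a', b', h, h1, h2, h3, h4⟩ :=
      ih (v :: r).length (by omega) rfl hl.right_of_append hvS hb
    exact ⟨l', a', b', h, h1, h2, fun w hw => List.mem_append_right _ (h3 w hw), h4⟩
  by_cases h2 : ∃ v ∈ l, v ∈ Y ∧ v ≠ b
  · obtain ⟨v, hv, hvY, hvb⟩ := h2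
    obtain ⟨p, r, rfl⟩ := List.append_of_mem hv
    have hp : r ≠ [] := by
      rintro rfl
      exact hvb (by simpa using hl.last)
    have hp' := List.length_pos_of_ne_nil hp
    simp only [List.length_append, List.length_cons] at hn
    obtain ⟨l', a', b', h, h1, h2, h3, h4⟩ :=
      ih (p ++ [v]).length (by simp; omega) rfl hl.left_of_append ha hvY
    refine ⟨l', a', b', h, h1, h2, fun w hw => ?_, h4⟩
    have := h3 w hw
    simp only [List.mem_append, List.mem_cons, List.not_mem_nil, or_false] at this ⊢
    tauto
  push Not at h1 h2
  exact ⟨l, a, b, hl, ha, hb, fun _ h => h, h1, h2⟩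

/-- A path from `X` to `Y` without inner vertices in `X` or `Y`. -/
structure Link (G : SimpleGraph V) (X Y : Set V) (W : List V) (a b : V) : Prop where
  path : Pth G W a b
  left : a ∈ X
  right : b ∈ Y
  left_unique : ∀ v ∈ W, v ∈ X → v = a
  right_unique : ∀ v ∈ W, v ∈ Y → v = b

/-- Two disjoint paths between `X` and `Y` in a 2-connected graph, retaining the ends of
a given path. -/
lemma exists_disjoint_links (hG : Conn2 G) {X : Set V} (hX : ∀ v, ∃ a ∈ X, a ≠ v) :
    ∀ (n : ℕ) {Y : Set V} {q : List V} {s t : V}, q.length = n → (∀ v, ∃ b ∈ Y, b ≠ v) →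
      Link G X Y q s t → ∃ W₁ W₂ a₁ a₂ b₂, Link G X Y W₁ a₁ t ∧ Link G X Y W₂ a₂ b₂ ∧
        (∀ v ∈ W₁, v ∉ W₂) ∧ (s = a₁ ∨ s = a₂) := by
  intro n
  induction n with
  | zero =>
    intro Y q s t hn _ hq
    exact absurd (List.length_eq_zero_iff.1 hn) hq.path.ne_nil
  | succ n ih =>
  intro Y q s t hn hY hq
  obtain ⟨q', rfl⟩ : ∃ q', q = q' ++ [t] := by
    have := hq.path.last
    rwa [List.getLast?_eq_some_iff] at this
  obtain ⟨a0, ha0, ha0t⟩ := hX t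
  obtain ⟨b0, hb0, hb0t⟩ := hY t
  obtain ⟨Z0, hZ0, htZ0⟩ := hG t a0 b0 ha0t hb0t
  by_cases hq' : q' = []
  · subst hq'
    have hst : s = t := by simpa using hq.path.head.symm
    subst hst
    obtain ⟨Z, z, y, hZ, hz, hy, hsub, h1, h2⟩ := hZ0.exists_minimal _ rfl ha0 hb0
    refine ⟨_, Z, s, z, y, hq, ⟨hZ, hz, hy, h1, h2⟩, ?_, Or.inl rfl⟩
    intro v hv hv'
    simp only [List.nil_append, List.mem_singleton] at hv
    subst hv
    exact htZ0 (hsub _ hv')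
  obtain ⟨q'', u, rfl⟩ : ∃ m'' c, q' = m'' ++ [c] := by
    obtain h | ⟨x, y, h⟩ := List.eq_nil_or_concat q'
    · exact absurd h hq'
    · exact ⟨x, y, by simpa using h⟩
  have hnd := hq.path.nodup
  have htq : t ∉ q'' ++ [u] := by
    rw [List.nodup_append] at hnd
    intro h
    exact hnd.2.2 t h t (by simp) rfl
  have hut : G.Adj u t := by
    have := (List.isChain_append.1 hq.path.chain).2.2
    simpa using this
  have hqp : Pth G (q'' ++ [u]) s u := by
    have : Pth G (q'' ++ u :: [t]) s t := by simpa using hq.path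
    exact this.left_of_append
  have hmem : ∀ v ∈ q'' ++ [u], v ∈ q'' ++ [u] ++ [t] := fun v hv => List.mem_append_left _ hv
  have huY : u ∉ Y := fun h => by
    have := hq.right_unique u (by simp) h
    exact htq (this ▸ by simp)
  have htX : t ∉ X := fun h => by
    have := hq.left_unique t (by simp) h
    exact htq (this ▸ hqp.head_mem)
  obtain ⟨W₁, W₂, a₁, a₂, y, h1, h2, hdis, hs⟩ := ih (Y := insert u Y) (q := q'' ++ [u]) (s := s)
    (t := u) (by simpa using hn)
    (fun v => (hY v).imp fun b hb => ⟨Or.inr hb.1, hb.2⟩)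
    ⟨hqp, hq.left, Or.inl rfl, fun v hv hvX => hq.left_unique v (hmem v hv) hvX, by
      rintro v hv (hvu | hvY)
      · exact hvu
      · have := hq.right_unique v (hmem v hv) hvY
        exact absurd (this ▸ hv) htq⟩
  have hyu : y ≠ u := fun h => hdis u h1.path.last_mem (h ▸ h2.path.last_mem)
  have hyY : y ∈ Y := by
    rcases h2.right with h | h
    · exact absurd h hyu
    · exact h
  have htu : t ≠ u := hut.ne'
  have htW1 : t ∉ W₁ := fun h => htu (h1.right_unique t h (Or.inr hq.right))
  have hW1Y : ∀ v ∈ W₁, v ∉ Y := fun v hv hvY => huY (h1.right_unique v hv (Or.inr hvY) ▸ hvY)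
  have hL1 : Link G X Y (W₁ ++ [t]) a₁ t := by
    refine ⟨h1.path.concat hut htW1, h1.left, hq.right, ?_, ?_⟩
    · intro v hv hvX
      simp only [List.mem_append, List.mem_singleton] at hv
      rcases hv with hv | rfl
      · exact h1.left_unique v hv hvX
      · exact absurd hvX htX
    · intro v hv hvY
      simp only [List.mem_append, List.mem_singleton] at hv
      rcases hv with hv | rfl
      · exact absurd hvY (hW1Y v hv)
      · rfl
  have hL2 : Link G X Y W₂ a₂ y :=
    ⟨h2.path, h2.left, hyY, h2.left_unique, fun v hv hvY => h2.right_unique v hv (Or.inr hvY)⟩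
  by_cases hyt : y = t
  swap
  · refine ⟨W₁ ++ [t], W₂, a₁, a₂, y, hL1, hL2, ?_, hs⟩
    intro v hv hv'
    simp only [List.mem_append, List.mem_singleton] at hv
    rcases hv with hv | rfl
    · exact hdis v hv hv'
    · exact hyt (hL2.right_unique _ hv' hq.right).symm
  subst hyt
  obtain ⟨Z, z, y', hZ, hz, hy', hsub, hZS, hZY⟩ :=
    hZ0.exists_minimal (S := X ∪ {v | v ∈ W₁ ∨ v ∈ W₂}) (Y := Y) _ rfl (Or.inl ha0) hb0
  have htZ : y ∉ Z := fun h => htZ0 (hsub _ h)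
  have hzt : z ≠ y := fun h => htZ (h ▸ hZ.head_mem)
  by_cases hz1 : z ∈ W₁
  · obtain ⟨p, r, rfl⟩ := List.append_of_mem hz1
    obtain ⟨W, hW, hWm⟩ := h1.path.left_of_append.trans hZ (by
      intro v hv hv'
      refine hZS v hv' (Or.inr (Or.inl ?_))
      simp only [List.mem_append, List.mem_cons, List.not_mem_nil, or_false] at hv ⊢
      tauto)
    have hpre : ∀ v ∈ p ++ [z], v ∈ p ++ z :: r := by
      intro v hv
      simp only [List.mem_append, List.mem_cons, List.not_mem_nil, or_false] at hv ⊢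
      tauto
    refine ⟨W₂, W, a₂, a₁, y', hL2, ⟨hW, h1.left, hy', ?_, ?_⟩, ?_, hs.symm⟩
    · intro v hv hvX
      rcases (hWm v).1 hv with hv | hv
      · exact h1.left_unique v (hpre v hv) hvX
      · have := hZS v hv (Or.inl hvX)
        subst this
        exact h1.left_unique v (by simp) hvX
    · intro v hv hvY
      rcases (hWm v).1 hv with hv | hv
      · exact absurd hvY (hW1Y v (hpre v hv))
      · exact hZY v hv hvY
    · intro v hv hv'
      rcases (hWm v).1 hv' with hv' | hv'
      · exact hdis v (hpre v hv') hv
      · have := hZS v hv' (Or.inr (Or.inr hv))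
        subst this
        exact hdis v (by simp) hv
  by_cases hz2 : z ∈ W₂
  · obtain ⟨p, r, rfl⟩ := List.append_of_mem hz2
    obtain ⟨W, hW, hWm⟩ := h2.path.left_of_append.trans hZ (by
      intro v hv hv'
      refine hZS v hv' (Or.inr (Or.inr ?_))
      simp only [List.mem_append, List.mem_cons, List.not_mem_nil, or_false] at hv ⊢
      tauto)
    have hpre : ∀ v ∈ p ++ [z], v ∈ p ++ z :: r := by
      intro v hv
      simp only [List.mem_append, List.mem_cons, List.not_mem_nil, or_false] at hv ⊢
      tauto
    have htp : y ∉ p ++ [z] := by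
      have hyr : y ∈ r := by
        have := h2.path.right_of_append.last_mem
        simpa [Ne.symm hzt] using this
      have hnd := h2.path.nodup
      intro h
      have h5 : ((p ++ [z]) ++ r).Nodup := by simpa using hnd
      exact (List.nodup_append.1 h5).2.2 y h y hyr rfl
    refine ⟨W₁ ++ [y], W, a₁, a₂, y', hL1, ⟨hW, h2.left, hy', ?_, ?_⟩, ?_, hs⟩
    · intro v hv hvX
      rcases (hWm v).1 hv with hv | hv
      · exact h2.left_unique v (hpre v hv) hvX
      · have := hZS v hv (Or.inl hvX)
        subst this
        exact h2.left_unique v (by simp) hvX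
    · intro v hv hvY
      rcases (hWm v).1 hv with hv | hv
      · exact absurd (hL2.right_unique v (hpre v hv) hvY ▸ hv) htp
      · exact hZY v hv hvY
    · intro v hv hv'
      simp only [List.mem_append, List.mem_singleton] at hv
      rcases hv with hv | rfl
      · rcases (hWm v).1 hv' with hv' | hv'
        · exact hdis v hv (hpre v hv')
        · have := hZS v hv' (Or.inr (Or.inl hv))
          subst this
          exact hz1 hv
      · rcases (hWm v).1 hv' with hv' | hv'
        · exact htp hv'
        · exact htZ hv'
  have hzX : z ∈ X := by
    rcases hz with h | h | h
    · exact h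
    · exact absurd h hz1
    · exact absurd h hz2
  have hLZ : Link G X Y Z z y' := ⟨hZ, hzX, hy', fun v hv h => hZS v hv (Or.inl h), hZY⟩
  rcases hs with hs | hs
  · refine ⟨W₁ ++ [y], Z, a₁, z, y', hL1, hLZ, ?_, Or.inl hs⟩
    intro v hv hv'
    simp only [List.mem_append, List.mem_singleton] at hv
    rcases hv with hv | rfl
    · exact hz1 (hZS v hv' (Or.inr (Or.inl hv)) ▸ hv)
    · exact htZ hv'
  · refine ⟨W₂, Z, a₂, z, y', hL2, hLZ, ?_, Or.inl hs⟩
    intro v hv hv'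
    exact hz2 (hZS v hv' (Or.inr (Or.inr hv)) ▸ hv)

variable [Fintype V] [DecidableEq V]

/-- If every vertex of `W` is reachable inside `W` from a root in `R`, and `W` contains enough
vertices of `A`, then some path inside `W` from a root ends in a vertex of `A` all of whose
neighbours in `W` lie on the path. -/
lemma exists_locked_in {A : Finset V} (hA : Bip G A) : ∀ (n : ℕ) (W R : Finset V), W.card = n →
    (∀ w ∈ W, ∃ r ∈ R, ∃ l, Pth G l r w ∧ ∀ v ∈ l, v ∈ W) →
    ((W \ A).card < (W ∩ A).card ∨ (W \ A).card ≤ (W ∩ A).card ∧ ∃ z ∈ R, z ∈ W ∧ z ∉ A) →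
    ∃ l z x, z ∈ R ∧ Pth G l z x ∧ x ∈ A ∧ (∀ v ∈ l, v ∈ W) ∧ ∀ v ∈ W, G.Adj x v → v ∈ l := by
  classical
  intro n
  induction n using Nat.strong_induction_on with
  | _ n ih =>
  intro W R hn hR hc
  have key : ∀ z ∈ R, z ∈ W → ∃ H : Finset V, z ∈ H ∧ H ⊆ W ∧
      (∀ u ∈ H, ∀ v ∈ W, G.Adj u v → v ∈ H) ∧
      (∀ w ∈ W \ H, ∃ r ∈ R, ∃ l, Pth G l r w ∧ ∀ v ∈ l, v ∈ W \ H) ∧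
      (∀ w ∈ H.erase z, ∃ r ∈ Finset.univ.filter (G.Adj z), ∃ l, Pth G l r w ∧
        ∀ v ∈ l, v ∈ H.erase z) := by
    intro z hz hzW
    refine ⟨W.filter fun w => ∃ l, Pth G l z w ∧ ∀ v ∈ l, v ∈ W, ?_, Finset.filter_subset _ _,
      ?_, ?_, ?_⟩
    · exact Finset.mem_filter.2 ⟨hzW, [z], Pth.singleton z, by simpa using hzW⟩
    · intro u hu v hv huv
      rw [Finset.mem_filter] at hu ⊢
      obtain ⟨-, l, hl, hlW⟩ := hu
      refine ⟨hv, ?_⟩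
      by_cases hvl : v ∈ l
      · obtain ⟨p, r, rfl⟩ := List.append_of_mem hvl
        refine ⟨_, hl.left_of_append, fun x hx => hlW x ?_⟩
        simp only [List.mem_append, List.mem_cons, List.not_mem_nil, or_false] at hx ⊢
        tauto
      · refine ⟨_, hl.concat huv hvl, fun x hx => ?_⟩
        simp only [List.mem_append, List.mem_singleton] at hx
        rcases hx with hx | rfl
        · exact hlW x hx
        · exact hv
    · intro w hw
      rw [Finset.mem_sdiff, Finset.mem_filter] at hw
      obtain ⟨r, hr, l, hl, hlW⟩ := hR w hw.1
      refine ⟨r, hr, l, hl, fun v hv => Finset.mem_sdiff.2 ⟨hlW v hv, fun hvH => hw.2 ?_⟩⟩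
      obtain ⟨-, m, hm, hmW⟩ := Finset.mem_filter.1 hvH
      refine ⟨hw.1, ?_⟩
      obtain ⟨p, q, rfl⟩ := List.append_of_mem hv
      have h1 := hl.right_of_append
      obtain ⟨t', x', y', ht', hx', hy', hts', -, htY'⟩ :=
        h1.reverse.exists_minimal (S := {w}) (Y := {v | v ∈ m}) _ rfl rfl hm.last_mem
      simp only [Set.mem_singleton_iff] at hx'
      subst hx'
      obtain ⟨m1, m2, rfl⟩ := List.append_of_mem hy'
      obtain ⟨u, hu, hum⟩ := hm.left_of_append.trans ht'.reverse (by
        intro v hv hv'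
        refine htY' v (by simpa using hv') ?_
        simp only [List.mem_append, List.mem_cons, List.not_mem_nil, or_false,
          Set.mem_ofPred_eq] at hv ⊢
        tauto)
      refine ⟨u, hu, fun v hv => ?_⟩
      rcases (hum v).1 hv with hv | hv
      · refine hmW v ?_
        simp only [List.mem_append, List.mem_cons, List.not_mem_nil, or_false] at hv ⊢
        tauto
      · refine hlW v (List.mem_append_right _ ?_)
        have := hts' v (by simpa using hv)
        simpa only [List.mem_reverse] using this
    · intro w hw
      rw [Finset.mem_erase, Finset.mem_filter] at hw
      obtain ⟨hwz, hwW, l, hl, hlW⟩ := hw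
      obtain ⟨l', rfl⟩ : ∃ l', l = z :: l' := by
        cases l with
        | nil => simpa using hl.head
        | cons x m' => exact ⟨m', by simpa using hl.head⟩
      cases l' with
      | nil => exact absurd (by simpa using hl.last.symm) hwz
      | cons y l' =>
        have hzy : G.Adj z y := by
          have := hl.chain
          simp only [List.isChain_cons_cons] at this
          exact this.1
        have hl' : Pth G (y :: l') y w := by
          have : Pth G ([z] ++ y :: l') z w := hl
          exact this.right_of_append
        refine ⟨y, by simpa using hzy, _, hl', fun v hv => ?_⟩
        have hzn := (List.nodup_cons.1 hl.nodup).1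
        rw [Finset.mem_erase, Finset.mem_filter]
        refine ⟨fun h => hzn (h ▸ hv), hlW v (List.mem_cons_of_mem _ hv), ?_⟩
        obtain ⟨p, q, hpq⟩ := List.append_of_mem (List.mem_cons_of_mem z hv)
        rw [hpq] at hl hlW
        refine ⟨_, hl.left_of_append, fun x hx => hlW x ?_⟩
        simp only [List.mem_append, List.mem_cons, List.not_mem_nil, or_false] at hx ⊢
        tauto
  have card1 : ∀ H ⊆ W, (W ∩ A).card = (H ∩ A).card + ((W \ H) ∩ A).card ∧
      (W \ A).card = (H \ A).card + ((W \ H) \ A).card := by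
    intro H hH
    constructor
    · rw [← Finset.card_union_of_disjoint]
      · congr 1; ext v; have := @hH v; simp only [Finset.mem_inter, Finset.mem_union,
          Finset.mem_sdiff]; tauto
      · rw [Finset.disjoint_left]; intro v hv; simp only [Finset.mem_inter,
          Finset.mem_sdiff] at hv ⊢; tauto
    · rw [← Finset.card_union_of_disjoint]
      · congr 1; ext v; have := @hH v; simp only [Finset.mem_union,
          Finset.mem_sdiff]; tauto
      · rw [Finset.disjoint_left]; intro v hv; simp only [
          Finset.mem_sdiff] at hv ⊢; tauto
  have rest : ∀ z, ∀ H : Finset V, z ∈ H → H ⊆ W →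
      (∀ u ∈ H, ∀ v ∈ W, G.Adj u v → v ∈ H) →
      (∀ w ∈ W \ H, ∃ r ∈ R, ∃ l, Pth G l r w ∧ ∀ v ∈ l, v ∈ W \ H) →
      ((W \ H) \ A).card < ((W \ H) ∩ A).card →
      ∃ l z x, z ∈ R ∧ Pth G l z x ∧ x ∈ A ∧ (∀ v ∈ l, v ∈ W) ∧ ∀ v ∈ W, G.Adj x v → v ∈ l := by
    intro z H hzH hHW hcl hreach hcard
    have hlt : (W \ H).card < n := by
      rw [← hn]
      exact Finset.card_lt_card (Finset.sdiff_ssubset hHW ⟨z, hzH⟩)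
    obtain ⟨l, y, x, hy, hl, hx, hlH, hlock⟩ := ih _ hlt _ _ rfl hreach (Or.inl hcard)
    have hxH := Finset.mem_sdiff.1 (hlH x hl.last_mem)
    refine ⟨l, y, x, hy, hl, hx, fun v hv => (Finset.mem_sdiff.1 (hlH v hv)).1, ?_⟩
    intro v hv hxv
    exact hlock v (Finset.mem_sdiff.2 ⟨hv, fun h => hxH.2 (hcl v h x hxH.1 hxv.symm)⟩) hxv
  have inner : ∀ z ∈ R, ∀ H : Finset V, z ∈ H → H ⊆ W →
      (∀ u ∈ H, ∀ v ∈ W, G.Adj u v → v ∈ H) →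
      (∀ w ∈ H.erase z, ∃ r ∈ Finset.univ.filter (G.Adj z), ∃ l, Pth G l r w ∧
        ∀ v ∈ l, v ∈ H.erase z) →
      ((H.erase z \ A).card < (H.erase z ∩ A).card ∨ (H.erase z \ A).card ≤ (H.erase z ∩ A).card ∧
        ∃ y ∈ Finset.univ.filter (G.Adj z), y ∈ H.erase z ∧ y ∉ A) →
      ∃ l z x, z ∈ R ∧ Pth G l z x ∧ x ∈ A ∧ (∀ v ∈ l, v ∈ W) ∧ ∀ v ∈ W, G.Adj x v → v ∈ l := by
    intro z hz H hzH hHW hcl hreach hcard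
    have hlt : (H.erase z).card < n := by
      rw [← hn]
      exact Finset.card_lt_card ((Finset.erase_ssubset hzH).trans_subset hHW)
    obtain ⟨l, y, x, hy, hl, hx, hlH, hlock⟩ := ih _ hlt _ _ rfl hreach hcard
    have hxH := hlH x hl.last_mem
    refine ⟨z :: l, z, x, hz, hl.cons (by simpa using hy)
      (fun h => (Finset.mem_erase.1 (hlH z h)).1 rfl), hx, ?_, ?_⟩
    · intro v hv
      rcases List.mem_cons.1 hv with rfl | hv
      · exact hHW hzH
      · exact hHW (Finset.mem_of_mem_erase (hlH v hv))
    · intro v hv hxv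
      by_cases hvz : v = z
      · simp [hvz]
      · exact List.mem_cons_of_mem _ (hlock v (Finset.mem_erase.2
          ⟨hvz, hcl x (Finset.mem_of_mem_erase hxH) v hv hxv⟩) hxv)
  by_cases hB : ∃ z ∈ R, z ∈ W ∧ z ∉ A
  · obtain ⟨z, hz, hzW, hzA⟩ := hB
    obtain ⟨H, hzH, hHW, hcl, hr1, hr2⟩ := key z hz hzW
    have hWle : (W \ A).card ≤ (W ∩ A).card := by omega
    have hc1 := card1 H hHW
    by_cases hle : (H \ A).card ≤ (H ∩ A).card
    · refine inner z hz H hzH hHW hcl hr2 (Or.inl ?_)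
      have e1 : H.erase z \ A = (H \ A).erase z := by
        ext v; simp only [Finset.mem_sdiff, Finset.mem_erase]; tauto
      have e2 : H.erase z ∩ A = H ∩ A := by
        ext v; simp only [Finset.mem_inter, Finset.mem_erase]
        constructor
        · tauto
        · rintro ⟨h1, h2⟩; exact ⟨⟨fun h => hzA (h ▸ h2), h1⟩, h2⟩
      have hzm : z ∈ H \ A := Finset.mem_sdiff.2 ⟨hzH, hzA⟩
      have := Finset.card_pos.2 ⟨z, hzm⟩
      rw [e1, e2, Finset.card_erase_of_mem hzm]
      omega
    · exact rest z H hzH hHW hcl hr1 (by omega)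
  · have hlt : (W \ A).card < (W ∩ A).card := hc.resolve_right fun h => hB h.2
    obtain ⟨w, hw⟩ : (W ∩ A).Nonempty := Finset.card_pos.1 (by omega)
    obtain ⟨z, hz, l, hl, hlW⟩ := hR w (Finset.mem_inter.1 hw).1
    have hzW := hlW z hl.head_mem
    have hzA : z ∈ A := by by_contra h; exact hB ⟨z, hz, hzW, h⟩
    obtain ⟨H, hzH, hHW, hcl, hr1, hr2⟩ := key z hz hzW
    have hc1 := card1 H hHW
    by_cases hle : (H \ A).card < (H ∩ A).card
    · by_cases hemp : H.erase z = ∅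
      · refine ⟨[z], z, z, hz, Pth.singleton z, hzA, by simpa using hzW, ?_⟩
        intro v hv hzv
        have h1 := hcl z hzH v hv hzv
        have h2 : v ∈ H.erase z := Finset.mem_erase.2 ⟨hzv.ne', h1⟩
        simp [hemp] at h2
      · obtain ⟨w', hw'⟩ := Finset.nonempty_iff_ne_empty.2 hemp
        obtain ⟨r, hr, l', hl', hl'H⟩ := hr2 w' hw'
        refine inner z hz H hzH hHW hcl hr2 (Or.inr ⟨?_, r, hr, hl'H r hl'.head_mem, ?_⟩)
        · have e1 : H.erase z \ A = H \ A := by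
            ext v; simp only [Finset.mem_sdiff, Finset.mem_erase]
            constructor
            · tauto
            · rintro ⟨h1, h2⟩; exact ⟨⟨fun h => h2 (h ▸ hzA), h1⟩, h2⟩
          have e2 : H.erase z ∩ A = (H ∩ A).erase z := by
            ext v; simp only [Finset.mem_inter, Finset.mem_erase]; tauto
          rw [e1, e2, Finset.card_erase_of_mem (Finset.mem_inter.2 ⟨hzH, hzA⟩)]
          omega
        · exact (hA z r (by simpa using hr)).1 hzA
    · exact rest z H hzH hHW hcl hr1 (by omega)

end

section

variable {V : Type*} {G : SimpleGraph V}

/-- `f 0, …, f n` is a path of `G`. -/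
structure PathFun (G : SimpleGraph V) (f : ℕ → V) (n : ℕ) : Prop where
  adj : ∀ i < n, G.Adj (f i) (f (i + 1))
  inj : ∀ i j, i ≤ n → j ≤ n → f i = f j → i = j

/-- The list `f i, …, f j`. -/
def seg (f : ℕ → V) (i j : ℕ) : List V := (List.range (j + 1 - i)).map fun u => f (i + u)

lemma mem_seg {f : ℕ → V} {i j : ℕ} {v : V} : v ∈ seg f i j ↔ ∃ u, i ≤ u ∧ u ≤ j ∧ f u = v := by
  simp only [seg, List.mem_map, List.mem_range]
  constructor
  · rintro ⟨u, hu, rfl⟩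
    exact ⟨i + u, by omega, by omega, rfl⟩
  · rintro ⟨u, h1, h2, rfl⟩
    exact ⟨u - i, by omega, by congr 1; omega⟩

lemma apply_mem_seg {f : ℕ → V} {i j u : ℕ} (h1 : i ≤ u) (h2 : u ≤ j) : f u ∈ seg f i j :=
  mem_seg.2 ⟨u, h1, h2, rfl⟩

lemma length_seg (f : ℕ → V) (i j : ℕ) : (seg f i j).length = j + 1 - i := by simp [seg]

namespace PathFun

variable {f : ℕ → V} {n : ℕ}

lemma seg_pth (hf : PathFun G f n) {i j : ℕ} (hij : i ≤ j) (hj : j ≤ n) :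
    Pth G (seg f i j) (f i) (f j) := by
  obtain ⟨d, rfl⟩ := Nat.exists_eq_add_of_le hij
  induction d with
  | zero => simpa [seg] using Pth.singleton (G := G) (f i)
  | succ d ih =>
    have h1 := ih (by omega) (by omega)
    have h2 : seg f i (i + (d + 1)) = seg f i (i + d) ++ [f (i + (d + 1))] := by
      simp only [seg]
      rw [show i + (d + 1) + 1 - i = (i + d + 1 - i) + 1 by omega, List.range_succ, List.map_append]
      simp only [List.map_cons, List.map_nil]
      congr 3
      omega
    rw [h2]
    refine h1.concat (hf.adj _ (by omega)) ?_
    rw [mem_seg]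
    rintro ⟨u, h3, h4, h5⟩
    have := hf.inj _ _ (by omega) (by omega) h5
    omega

lemma seg_disjoint (hf : PathFun G f n) {i j i' j' : ℕ} (hj : j < i') (hj' : j' ≤ n) :
    ∀ v ∈ seg f i j, v ∉ seg f i' j' := by
  intro v hv hv'
  obtain ⟨u, h1, h2, rfl⟩ := mem_seg.1 hv
  obtain ⟨w, h3, h4, h5⟩ := mem_seg.1 hv'
  have := hf.inj _ _ (by omega) (by omega) h5
  omega

lemma rev (hf : PathFun G f n) : PathFun G (fun i => f (n - i)) n := by
  refine ⟨fun i hi => ?_, fun i j hi hj h => ?_⟩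
  · have := hf.adj (n - (i + 1)) (by omega)
    rw [show n - (i + 1) + 1 = n - i by omega] at this
    exact this.symm
  · have := hf.inj _ _ (by omega) (by omega) h
    omega

lemma mem_iff {A : Finset V} (hA : Bip G A) (hf : PathFun G f n) (h0 : f 0 ∈ A) {i : ℕ}
    (hi : i ≤ n) : f i ∈ A ↔ i % 2 = 0 := by
  induction i with
  | zero => simpa using h0
  | succ i ih =>
    have h1 := ih (by omega)
    have h2 := hA _ _ (hf.adj i (by omega))
    have h3 : f (i + 1) ∈ A ↔ ¬ (i % 2 = 0) := by tauto
    rw [h3]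
    omega

end PathFun

lemma Pth.exists_pathFun {l : List V} {a b : V} (h : Pth G l a b) :
    ∃ f n, PathFun G f n ∧ f 0 = a ∧ f n = b ∧ l.length = n + 1 ∧ seg f 0 n = l := by
  have hpos := List.length_pos_of_ne_nil h.ne_nil
  refine ⟨fun i => l.getD i a, l.length - 1, ⟨?_, ?_⟩, ?_, ?_, by omega, ?_⟩
  · intro i hi
    have h1 : i < l.length := by omega
    have h2 : i + 1 < l.length := by omega
    simp only [List.getD_eq_getElem _ _ h1, List.getD_eq_getElem _ _ h2]
    exact (List.isChain_iff_getElem.1 h.chain) i h2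
  · intro i j hi hj hij
    have h1 : i < l.length := by omega
    have h2 : j < l.length := by omega
    simp only [List.getD_eq_getElem _ _ h1, List.getD_eq_getElem _ _ h2] at hij
    exact (h.nodup.getElem_inj_iff).1 hij
  · have := h.head
    rw [List.head?_eq_getElem?] at this
    simp [List.getD, this]
  · have := h.last
    rw [List.getLast?_eq_getElem?] at this
    simp [List.getD, this]
  · apply List.ext_getElem
    · rw [length_seg]; omega
    · intro i h1 h2
      simp [seg, h2]

/-- The neighbours of `v`. -/
noncomputable def nb [Fintype V] (G : SimpleGraph V) (v : V) : Finset V := by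
  classical exact Finset.univ.filter (G.Adj v)

lemma mem_nb [Fintype V] {v w : V} : w ∈ nb G v ↔ G.Adj v w := by simp [nb]

/-- The indices of the neighbours of `v` on the path `f 0, …, f n`. -/
noncomputable def nbIdx (G : SimpleGraph V) (f : ℕ → V) (n : ℕ) (v : V) : Finset ℕ := by
  classical exact (Finset.range (n + 1)).filter fun i => G.Adj v (f i)

lemma mem_nbIdx {f : ℕ → V} {n : ℕ} {v : V} {i : ℕ} :
    i ∈ nbIdx G f n v ↔ i ≤ n ∧ G.Adj v (f i) := by simp [nbIdx]

lemma card_nb_le [Fintype V] {f : ℕ → V} {n : ℕ} {v : V}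
    (h : ∀ w, G.Adj v w → w ∈ seg f 0 n) : (nb G v).card ≤ (nbIdx G f n v).card := by
  classical
  refine (Finset.card_le_card (t := (nbIdx G f n v).image f) fun w hw => ?_).trans
    Finset.card_image_le
  rw [mem_nb] at hw
  obtain ⟨i, -, hi, rfl⟩ := mem_seg.1 (h w hw)
  exact Finset.mem_image.2 ⟨i, mem_nbIdx.2 ⟨hi, hw⟩, rfl⟩

namespace PathFun

variable {f : ℕ → V} {n : ℕ}

lemma hasCyc [DecidableEq V] {A : Finset V} (hA : Bip G A) (hf : PathFun G f n) {l : List V}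
    (hl : Cyc G l) (I : Finset ℕ) (hI : ∀ i ∈ I, i ≤ n ∧ f i ∈ A ∧ f i ∈ l) {m : ℕ} (hm : 2 ≤ m)
    (hmI : m ≤ I.card) : HasCyc G m := by
  refine hl.hasCyc hA (S := I.image f) ?_ ?_ hm ?_
  · intro v hv
    obtain ⟨i, hi, rfl⟩ := Finset.mem_image.1 hv
    exact (hI i hi).2.1
  · intro v hv
    obtain ⟨i, hi, rfl⟩ := Finset.mem_image.1 hv
    exact (hI i hi).2.2
  · rwa [Finset.card_image_of_injOn]
    intro i hi j hj h
    exact hf.inj _ _ (hI i hi).1 (hI j hj).1 h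

lemma cyc_of_cross (hf : PathFun G f n) {i j : ℕ} (hij : i < j) (hj : j ≤ n)
    (hi : G.Adj (f n) (f i)) (h0 : G.Adj (f 0) (f j)) : Cyc G (seg f 0 i ++ (seg f j n).reverse) :=
  ⟨_, _, (hf.seg_pth (Nat.zero_le i) (by omega)).append (hf.seg_pth hj le_rfl).reverse hi.symm
    (fun v hv hv' => hf.seg_disjoint hij le_rfl v hv (by simpa using hv')), h0.symm⟩

lemma mem_cross {i j u : ℕ} (hu : u ≤ n) (h : u ≤ i ∨ j ≤ u) :
    f u ∈ seg f 0 i ++ (seg f j n).reverse := by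
  rw [List.mem_append, List.mem_reverse]
  rcases h with h | h
  · exact Or.inl (apply_mem_seg (Nat.zero_le u) h)
  · exact Or.inr (apply_mem_seg h hu)

/-- A path through the closed part `f 0, …, f s` of a lollipop which collects all neighbours
of `f 0` there and almost all their predecessors. -/
lemma exists_pth_collecting (hf : PathFun G f n) {p s : ℕ} (hp : p < s) (hs : s ≤ n)
    (h0 : G.Adj (f 0) (f s)) : ∃ L j, Pth G L (f p) (f s) ∧ G.Adj (f 0) (f j) ∧ j ≤ s ∧
      (∀ v ∈ L, v ∈ seg f 0 s) ∧
      ∀ i ≤ s, G.Adj (f 0) (f i) → f i ∈ L ∧ (i ≠ j → f (i - 1) ∈ L) := by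
  classical
  have hex : ∃ j, p < j ∧ G.Adj (f 0) (f j) := ⟨s, hp, h0⟩
  obtain ⟨hj1, hj2⟩ := Nat.find_spec hex
  have hjs : Nat.find hex ≤ s := Nat.find_min' hex ⟨hp, h0⟩
  have hmin : ∀ i, p < i → G.Adj (f 0) (f i) → Nat.find hex ≤ i :=
    fun i h1 h2 => Nat.find_min' hex ⟨h1, h2⟩
  generalize Nat.find hex = j at *
  refine ⟨(seg f 0 p).reverse ++ seg f j s, j,
    (hf.seg_pth (Nat.zero_le p) (by omega)).reverse.append (hf.seg_pth hjs hs) hj2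
      (fun v hv hv' => hf.seg_disjoint hj1 hs v (by simpa using hv) hv'), hj2, hjs, ?_, ?_⟩
  · intro v hv
    rw [List.mem_append, List.mem_reverse, mem_seg, mem_seg] at hv
    rw [mem_seg]
    rcases hv with ⟨u, h1, h2, rfl⟩ | ⟨u, h1, h2, rfl⟩
    · exact ⟨u, h1, by omega, rfl⟩
    · exact ⟨u, by omega, by omega, rfl⟩
  · have hm : ∀ u, u ≤ s → u ≤ p ∨ j ≤ u → f u ∈ (seg f 0 p).reverse ++ seg f j s := by
      intro u hu h
      rw [List.mem_append, List.mem_reverse]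
      rcases h with h | h
      · exact Or.inl (apply_mem_seg (Nat.zero_le u) h)
      · exact Or.inr (apply_mem_seg h hu)
    intro i hi hadj
    have := hmin i
    refine ⟨hm i hi ?_, fun hne => hm (i - 1) (by omega) ?_⟩
    · by_cases h : p < i
      · exact Or.inr (this h hadj)
      · left; omega
    · by_cases h : p < i
      · have := this h hadj
        right; omega
      · left; omega

end PathFun

/-- Two disjoint links between `X` and `Y` close up with a path inside `X` and a path
inside `Y`. -/
lemma exists_cyc_of_links {X Y : Set V} {L L' W W' : List V} {u s y y' : V}
    (hL : Pth G L u s) (hLX : ∀ v ∈ L, v ∈ X) (hW : Link G X Y W s y) (hL' : Pth G L' y y')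
    (hLY : ∀ v ∈ L', v ∈ Y) (hW' : Link G X Y W' u y') (hd : ∀ v ∈ W, v ∉ W')
    (hXY : ∀ v, v ∈ X → v ∈ Y → v ∈ W) :
    ∃ l, Cyc G l ∧ ∀ v, v ∈ L ∨ v ∈ L' → v ∈ l := by
  obtain ⟨P, hP, hPm⟩ := hL.trans hW.path fun v h1 h2 => hW.left_unique v h2 (hLX v h1)
  obtain ⟨Q, hQ, hQm⟩ := hP.trans hL' (by
    intro v h1 h2
    rcases (hPm v).1 h1 with h1 | h1
    · exact hW.right_unique v (hXY v (hLX v h1) (hLY v h2)) (hLY v h2)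
    · exact hW.right_unique v h1 (hLY v h2))
  have huy : u ≠ y' := by
    rintro rfl
    exact hd u (hXY u hW'.left hW'.right) hW'.path.head_mem
  obtain ⟨l, hl, hlm⟩ := hQ.close hW'.path.reverse huy (by
    intro v h1 h2
    rw [List.mem_reverse] at h2
    rcases (hQm v).1 h1 with h1 | h1
    · rcases (hPm v).1 h1 with h1 | h1
      · exact Or.inl (hW'.left_unique v h2 (hLX v h1))
      · exact absurd h2 (hd v h1)
    · exact Or.inr (hW'.right_unique v h2 (hLY v h1)))
  refine ⟨l, hl, fun v hv => ?_⟩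
  rw [hlm, hQm, hPm]
  tauto

namespace PathFun

variable {f : ℕ → V} {n : ℕ}

/-- If no neighbour of `f n` precedes a neighbour of `f 0`, there is a cycle collecting all
neighbours of both ends, and almost all predecessors of neighbours of `f 0`. -/
lemma exists_cyc_of_noncross (hG : Conn2 G) (hf : PathFun G f n) {s t : ℕ} (hst : s ≤ t)
    (ht : t ≤ n) (hs0 : G.Adj (f 0) (f s)) (htn : G.Adj (f n) (f t))
    (hsmax : ∀ i ≤ n, G.Adj (f 0) (f i) → i ≤ s) (htmin : ∀ i ≤ n, G.Adj (f n) (f i) → t ≤ i) :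
    ∃ l j, Cyc G l ∧ G.Adj (f 0) (f j) ∧ j ≤ n ∧
      (∀ i ≤ n, G.Adj (f 0) (f i) → f i ∈ l ∧ (i ≠ j → f (i - 1) ∈ l)) ∧
      ∀ i ≤ n, G.Adj (f n) (f i) → f i ∈ l := by
  have hs1 : 0 < s := by
    rcases Nat.eq_zero_or_pos s with h | h
    · subst h; exact absurd hs0 (G.loopless.irrefl _)
    · exact h
  have ht1 : t < n := by
    rcases Nat.lt_or_ge t n with h | h
    · exact h
    · have : t = n := by omega
      subst this; exact absurd htn (G.loopless.irrefl _)
  set X : Set V := {v | v ∈ seg f 0 s} with hX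
  set Y : Set V := {v | v ∈ seg f t n} with hY
  have hX2 : ∀ v, ∃ a ∈ X, a ≠ v := by
    intro v
    by_cases h : f 0 = v
    · refine ⟨f 1, apply_mem_seg (by omega) (by omega), fun h' => ?_⟩
      have := hf.inj 0 1 (by omega) (by omega) (h.trans h'.symm)
      omega
    · exact ⟨f 0, apply_mem_seg (by omega) (by omega), h⟩
  have hY2 : ∀ v, ∃ a ∈ Y, a ≠ v := by
    intro v
    by_cases h : f n = v
    · refine ⟨f t, apply_mem_seg (by omega) (by omega), fun h' => ?_⟩
      have := hf.inj n t (by omega) (by omega) (h.trans h'.symm)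
      omega
    · exact ⟨f n, apply_mem_seg (by omega) (by omega), h⟩
  have hq : Link G X Y (seg f s t) (f s) (f t) := by
    refine ⟨hf.seg_pth hst ht, apply_mem_seg (by omega) le_rfl, apply_mem_seg le_rfl ht, ?_, ?_⟩
    · intro v hv hv'
      obtain ⟨u, h1, h2, rfl⟩ := mem_seg.1 hv
      obtain ⟨w, h3, h4, h5⟩ := mem_seg.1 hv'
      have := hf.inj _ _ (by omega) (by omega) h5
      congr 1; omega
    · intro v hv hv'
      obtain ⟨u, h1, h2, rfl⟩ := mem_seg.1 hv
      obtain ⟨w, h3, h4, h5⟩ := mem_seg.1 hv'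
      have := hf.inj _ _ (by omega) (by omega) h5
      congr 1; omega
  have hXY : ∀ v, v ∈ X → v ∈ Y → v = f s ∧ v = f t := by
    intro v hv hv'
    obtain ⟨u, h1, h2, rfl⟩ := mem_seg.1 hv
    obtain ⟨w, h3, h4, h5⟩ := mem_seg.1 hv'
    have := hf.inj _ _ (by omega) (by omega) h5
    constructor <;> congr 1 <;> omega
  -- a path inside `Y` between `f t` and any other vertex of `Y`
  have hYpath : ∀ y ∈ Y, y ≠ f t → ∃ L, Pth G L y (f t) ∧ (∀ v ∈ L, v ∈ Y) ∧
      ∀ i ≤ n, G.Adj (f n) (f i) → f i ∈ L := by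
    intro y hy hyt
    obtain ⟨r, h1, h2, rfl⟩ := mem_seg.1 hy
    have hr : r ≠ t := fun h => hyt (by rw [h])
    obtain ⟨L, j, hL, -, -, hLs, hL2⟩ := hf.rev.exists_pth_collecting (p := n - r) (s := n - t)
      (by omega) (by omega) (by simpa [Nat.sub_sub_self ht] using htn)
    rw [Nat.sub_sub_self ht, Nat.sub_sub_self h2] at hL
    refine ⟨L, hL, fun v hv => ?_, fun i hi hadj => ?_⟩
    · obtain ⟨u, h3, h4, rfl⟩ := mem_seg.1 (hLs v hv)
      exact apply_mem_seg (by omega) (by omega)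
    · have h3 := htmin i hi hadj
      have := (hL2 (n - i) (by omega) (by simpa [Nat.sub_sub_self hi] using hadj)).1
      simpa [Nat.sub_sub_self hi] using this
  have hXpath : ∀ x ∈ X, x ≠ f s → ∃ L j, Pth G L x (f s) ∧ G.Adj (f 0) (f j) ∧ j ≤ s ∧
      (∀ v ∈ L, v ∈ X) ∧
      ∀ i ≤ s, G.Adj (f 0) (f i) → f i ∈ L ∧ (i ≠ j → f (i - 1) ∈ L) := by
    intro x hx hxs
    obtain ⟨p, h1, h2, rfl⟩ := mem_seg.1 hx
    have hp : p ≠ s := fun h => hxs (by rw [h])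
    exact hf.exists_pth_collecting (by omega) (by omega) hs0
  obtain ⟨W₁, W₂, a₁, a₂, b₂, h1, h2, hd, hs⟩ := exists_disjoint_links hG hX2 _ rfl hY2 hq
  have hb : b₂ ≠ f t := fun h => hd _ h1.path.last_mem (h ▸ h2.path.last_mem)
  obtain ⟨L', hL', hLY, hL'2⟩ := hYpath b₂ h2.right hb
  have haa : a₁ ≠ a₂ := fun h => hd _ h1.path.head_mem (h ▸ h2.path.head_mem)
  have finish : ∀ {L l : List V} {j : ℕ}, Cyc G l → G.Adj (f 0) (f j) → j ≤ s →
      (∀ i ≤ s, G.Adj (f 0) (f i) → f i ∈ L ∧ (i ≠ j → f (i - 1) ∈ L)) →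
      (∀ v, v ∈ L ∨ v ∈ L' → v ∈ l) → ∃ l j, Cyc G l ∧ G.Adj (f 0) (f j) ∧ j ≤ n ∧
      (∀ i ≤ n, G.Adj (f 0) (f i) → f i ∈ l ∧ (i ≠ j → f (i - 1) ∈ l)) ∧
      ∀ i ≤ n, G.Adj (f n) (f i) → f i ∈ l := by
    intro L l j hl hj hjs hL hm
    refine ⟨l, j, hl, hj, by omega, fun i hi hadj => ?_, fun i hi hadj => ?_⟩
    · have := hL i (hsmax i hi hadj) hadj
      exact ⟨hm _ (Or.inl this.1), fun h => hm _ (Or.inl (this.2 h))⟩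
    · exact hm _ (Or.inr (hL'2 i hi hadj))
  rcases hs with rfl | rfl
  · obtain ⟨L, j, hL, hj, hjs, hLX, hL2⟩ := hXpath a₂ h2.left (Ne.symm haa)
    obtain ⟨l, hl, hlm⟩ := exists_cyc_of_links hL hLX h1 hL'.reverse
      (fun v hv => hLY v (by simpa using hv)) h2 hd
      (fun v hv hv' => (hXY v hv hv').1 ▸ h1.path.head_mem)
    exact finish hl hj hjs hL2 (fun v hv => hlm v (by simpa using hv))
  · obtain ⟨L, j, hL, hj, hjs, hLX, hL2⟩ := hXpath a₁ h1.left haa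
    have hXYe : ∀ v, v ∈ X → v ∈ Y → False := by
      intro v hv hv'
      obtain ⟨h3, h4⟩ := hXY v hv hv'
      exact hd v (h4 ▸ h1.path.last_mem) (h3 ▸ h2.path.head_mem)
    obtain ⟨l, hl, hlm⟩ := exists_cyc_of_links hL hLX h2 hL' hLY h1
      (fun v hv hv' => hd v hv' hv) (fun v hv hv' => (hXYe v hv hv').elim)
    exact finish hl hj hjs hL2 hlm

variable [Fintype V] [DecidableEq V]

/-- A path with locked ends in different sides, whose ends do not see two consecutive vertices,
yields a long cycle. -/
lemma hasCyc_of_opposite {A : Finset V} (hA : Bip G A) (hG : Conn2 G) (hf : PathFun G f n)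
    (h0 : f 0 ∈ A) (hn : f n ∉ A) (hl0 : ∀ w, G.Adj (f 0) w → w ∈ seg f 0 n)
    (hln : ∀ w, G.Adj (f n) w → w ∈ seg f 0 n) {k l : ℕ} (hk : 2 ≤ k) (hl : 2 ≤ l)
    (hk0 : k ≤ (nb G (f 0)).card) (hkn : l ≤ (nb G (f n)).card)
    (hnc : ∀ i < n, G.Adj (f n) (f i) → ¬ G.Adj (f 0) (f (i + 1))) : HasCyc G (k + l - 1) := by
  have c0 := hk0.trans (card_nb_le hl0)
  have cn := hkn.trans (card_nb_le hln)
  have par0 : ∀ i ∈ nbIdx G f n (f 0), i % 2 = 1 := by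
    intro i hi
    rw [mem_nbIdx] at hi
    have h1 := (hA _ _ hi.2).1 h0
    rw [hf.mem_iff hA h0 hi.1] at h1
    omega
  have parn : ∀ i ∈ nbIdx G f n (f n), i % 2 = 0 := by
    intro i hi
    rw [mem_nbIdx] at hi
    have h1 := hA _ _ hi.2
    rw [← hf.mem_iff hA h0 hi.1]
    tauto
  have count : ∀ (C : List V) (j : ℕ), Cyc G C → j ∈ nbIdx G f n (f 0) →
      (∀ i ∈ nbIdx G f n (f 0), i ≠ j → f (i - 1) ∈ C) →
      (∀ i ∈ nbIdx G f n (f n), f i ∈ C) → HasCyc G (k + l - 1) := by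
    intro C j hC hj h1 h2
    refine hf.hasCyc hA hC (((nbIdx G f n (f 0)).erase j).image (· - 1) ∪ nbIdx G f n (f n))
      ?_ (by omega) ?_
    · intro i hi
      rw [Finset.mem_union, Finset.mem_image] at hi
      rcases hi with ⟨i', hi', rfl⟩ | hi
      · rw [Finset.mem_erase] at hi'
        have h3 := par0 _ hi'.2
        have h4 := (mem_nbIdx.1 hi'.2).1
        exact ⟨by omega, (hf.mem_iff hA h0 (by omega)).2 (by omega), h1 _ hi'.2 hi'.1⟩
      · have h4 := (mem_nbIdx.1 hi).1
        exact ⟨h4, (hf.mem_iff hA h0 h4).2 (parn i hi), h2 i hi⟩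
    · rw [Finset.card_union_of_disjoint, Finset.card_image_of_injOn, Finset.card_erase_of_mem hj]
      · omega
      · intro a ha b hb hab
        have h3 := par0 _ (Finset.mem_of_mem_erase ha)
        have h4 := par0 _ (Finset.mem_of_mem_erase hb)
        simp only at hab
        omega
      · rw [Finset.disjoint_left]
        intro i hi hi'
        obtain ⟨i', hi'', rfl⟩ := Finset.mem_image.1 hi
        have h5 := Finset.mem_of_mem_erase hi''
        have h3 := par0 _ h5
        rw [mem_nbIdx] at hi' h5
        refine hnc (i' - 1) (by omega) hi'.2 ?_
        rw [show i' - 1 + 1 = i' by omega]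
        exact h5.2
  by_cases hcr : ∃ d i j, i ∈ nbIdx G f n (f n) ∧ j ∈ nbIdx G f n (f 0) ∧ i < j ∧ j - i = d
  · classical
    obtain ⟨i, j, hi, hj, hij, hd⟩ := Nat.find_spec hcr
    have hmin : ∀ i' j', i' ∈ nbIdx G f n (f n) → j' ∈ nbIdx G f n (f 0) → i' < j' →
        j - i ≤ j' - i' := by
      intro i' j' h1 h2 h3
      rw [hd]
      exact Nat.find_min' hcr ⟨i', j', h1, h2, h3, rfl⟩
    refine count _ j (hf.cyc_of_cross hij (mem_nbIdx.1 hj).1 (mem_nbIdx.1 hi).2 (mem_nbIdx.1 hj).2)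
      hj ?_ ?_
    · intro i' hi' hne
      refine mem_cross (by have := (mem_nbIdx.1 hi').1; omega) ?_
      have h1 := par0 _ hi'
      have h2 := parn _ hi
      have h3 := par0 _ hj
      by_contra! h
      have := hmin i i' hi hi' (by omega)
      omega
    · intro i' hi'
      refine mem_cross (mem_nbIdx.1 hi').1 ?_
      by_contra! h
      have := hmin i' j hi' hj (by omega)
      omega
  · have hno : ∀ i ∈ nbIdx G f n (f n), ∀ j ∈ nbIdx G f n (f 0), j ≤ i := by
      intro i hi j hj
      by_contra! h
      exact hcr ⟨_, i, j, hi, hj, h, rfl⟩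
    have hne0 : (nbIdx G f n (f 0)).Nonempty := Finset.card_pos.1 (by omega)
    have hnen : (nbIdx G f n (f n)).Nonempty := Finset.card_pos.1 (by omega)
    have hs := Finset.max'_mem _ hne0
    have ht := Finset.min'_mem _ hnen
    obtain ⟨C, j, hC, hj, hjn, h1, h2⟩ := hf.exists_cyc_of_noncross hG (hno _ ht _ hs)
      (mem_nbIdx.1 ht).1 (mem_nbIdx.1 hs).2 (mem_nbIdx.1 ht).2
      (fun i hi hadj => Finset.le_max' _ _ (mem_nbIdx.2 ⟨hi, hadj⟩))
      (fun i hi hadj => Finset.min'_le _ _ (mem_nbIdx.2 ⟨hi, hadj⟩))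
    exact count C j hC (mem_nbIdx.2 ⟨hjn, hj⟩)
      (fun i hi hne => (h1 i (mem_nbIdx.1 hi).1 (mem_nbIdx.1 hi).2).2 hne)
      (fun i hi => h2 i (mem_nbIdx.1 hi).1 (mem_nbIdx.1 hi).2)

end PathFun

end

section

lemma exists_max_of_bounded {P : ℕ → Prop} {m : ℕ} (hb : ∀ q, P q → q ≤ m) (h : ∃ q, P q) :
    ∃ q, P q ∧ ∀ q', P q' → q' ≤ q := by
  classical
  obtain ⟨q, hq⟩ := h
  exact ⟨Nat.findGreatest P m, Nat.findGreatest_spec (hb q hq) hq,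
    fun q' hq' => Nat.le_findGreatest (hb q' hq') hq'⟩

variable {V : Type*} {G : SimpleGraph V}

lemma exists_longest [Fintype V] {P : List V → Prop} (hP : ∀ l, P l → l.Nodup) (h : ∃ l, P l) :
    ∃ l, P l ∧ ∀ l', P l' → l'.length ≤ l.length := by
  obtain ⟨l₀, hl₀⟩ := h
  obtain ⟨q, ⟨l, hl, rfl⟩, hmax⟩ := exists_max_of_bounded
    (P := fun q => ∃ l, P l ∧ l.length = q) (m := Fintype.card V)
    (by rintro q ⟨l, hl, rfl⟩; exact (hP l hl).length_le_card) ⟨_, l₀, hl₀, rfl⟩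
  exact ⟨l, hl, fun l' hl' => hmax _ ⟨l', hl', rfl⟩⟩

/-- `p` is a path starting in a vertex `x` of `A` and containing all neighbours of `x`. -/
structure Locked (G : SimpleGraph V) (A : Finset V) (p : List V) (x y : V) : Prop where
  path : Pth G p x y
  mem : x ∈ A
  lock : ∀ v, G.Adj x v → v ∈ p

/-- A 2-connected bipartite graph with sides `A` and its complement, of minimum degrees
`k ≥ 2` and `l ≥ 2`, where `A` is the larger side. -/
structure Setting [Fintype V] [DecidableEq V] (G : SimpleGraph V) (A : Finset V) (k l : ℕ) :
    Prop where
  bip : Bip G A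
  conn2 : Conn2 G
  conn : ∀ a b, ∃ p, Pth G p a b
  card_le : Aᶜ.card ≤ A.card
  two_le_left : 2 ≤ k
  two_le_right : 2 ≤ l
  deg_left : ∀ a ∈ A, k ≤ (nb G a).card
  deg_right : ∀ b ∉ A, l ≤ (nb G b).card

lemma Pth.exists_pred {p : List V} {a b : V} (h : Pth G p a b) (hab : a ≠ b) :
    ∃ p' c, p = p' ++ [b] ∧ Pth G p' a c ∧ G.Adj c b ∧ b ∉ p' := by
  obtain ⟨p', rfl⟩ : ∃ p', p = p' ++ [b] := by
    have := h.last
    rwa [List.getLast?_eq_some_iff] at this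
  obtain rfl | ⟨p'', c, rfl⟩ : p' = [] ∨ ∃ m'' c, p' = m'' ++ [c] := by
    obtain h | ⟨x, y, h⟩ := List.eq_nil_or_concat p'
    · exact Or.inl h
    · exact Or.inr ⟨x, y, by simpa using h⟩
  · exact absurd (by simpa using h.head.symm) hab
  refine ⟨_, c, rfl, ?_, ?_, ?_⟩
  · have : Pth G (p'' ++ c :: [b]) a b := by simpa using h
    exact this.left_of_append
  · have := (List.isChain_append.1 h.chain).2.2
    simpa using this
  · intro hb
    exact (List.nodup_append.1 h.nodup).2.2 b hb b (by simp) rfl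

lemma Cyc.card_inter [DecidableEq V] {A : Finset V} (hA : Bip G A) {C : List V} (hC : Cyc G C) :
    2 * (C.toFinset ∩ A).card = C.length ∧ 2 * (C.toFinset \ A).card = C.length := by
  have h1 := hC.count hA
  obtain ⟨a, b, hp, hba⟩ := hC
  have h2 : (C.filter (· ∈ A)).length = (C.toFinset ∩ A).card := by
    rw [← List.toFinset_card_of_nodup (hp.nodup.filter _)]
    congr 1
    ext v
    simp
  have h3 : (C.toFinset ∩ A).card + (C.toFinset \ A).card = C.length := by
    rw [Finset.card_inter_add_card_sdiff, List.toFinset_card_of_nodup hp.nodup]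
  omega

variable [Fintype V] [DecidableEq V] {A : Finset V} {k l : ℕ}

namespace Setting

lemma two_le_card_compl (S : Setting G A k l) [Nonempty V] : 2 ≤ Aᶜ.card := by
  have hpos := Fintype.card_pos (α := V)
  have h1 : A.card + Aᶜ.card = Fintype.card V := Finset.card_add_card_compl A
  have h2 := S.card_le
  obtain ⟨a, ha⟩ : A.Nonempty := Finset.card_pos.1 (by omega)
  refine (S.two_le_left.trans (S.deg_left a ha)).trans (Finset.card_le_card fun v hv => ?_)
  rw [mem_nb] at hv
  simpa using (S.bip _ _ hv).1 ha

/-- Every vertex off a closed path is joined to a neighbour of it off the closed path. -/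
lemma exists_pth_to (S : Setting G A k l) {C : List V} (hC : C ≠ []) {w : V} (hw : w ∉ C) :
    ∃ r, ∃ c ∈ C, ∃ p, G.Adj c r ∧ Pth G p w r ∧ ∀ v ∈ p, v ∉ C := by
  obtain ⟨c₀, hc₀⟩ := List.exists_mem_of_ne_nil C hC
  obtain ⟨p, hp⟩ := S.conn w c₀
  obtain ⟨q, w', c, hq, hw', hc, -, -, hY⟩ :=
    hp.exists_minimal (S := {w}) (Y := {v | v ∈ C}) _ rfl rfl hc₀
  simp only [Set.mem_singleton_iff] at hw'
  subst hw'
  obtain ⟨p', r, rfl, hp', hr, hcp⟩ := hq.exists_pred (fun h => hw (h ▸ hc))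
  refine ⟨r, c, hc, p', hr.symm, hp', fun v hv hvC => ?_⟩
  exact hcp (hY v (List.mem_append_left _ hv) hvC ▸ hv)

lemma card_outside (S : Setting G A k l) {C : List V} (hC : Cyc G C) :
    2 * ((Finset.univ \ C.toFinset) ∩ A).card + C.length = 2 * A.card ∧
    2 * ((Finset.univ \ C.toFinset) \ A).card + C.length = 2 * Aᶜ.card := by
  have h1 := hC.card_inter S.bip
  have h2 : ((Finset.univ \ C.toFinset) ∩ A).card + (C.toFinset ∩ A).card = A.card := by
    rw [← Finset.card_union_of_disjoint]
    · congr 1; ext v; simp only [Finset.mem_union, Finset.mem_inter, Finset.mem_sdiff,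
        Finset.mem_univ, true_and]; tauto
    · rw [Finset.disjoint_left]; intro v; simp only [Finset.mem_inter, Finset.mem_sdiff,
        Finset.mem_univ, true_and]; tauto
  have h3 : ((Finset.univ \ C.toFinset) \ A).card + (C.toFinset \ A).card = Aᶜ.card := by
    rw [← Finset.card_union_of_disjoint]
    · congr 1; ext v; simp only [Finset.mem_union, Finset.mem_sdiff, Finset.mem_compl,
        Finset.mem_univ, true_and]; tauto
    · rw [Finset.disjoint_left]; intro v; simp only [Finset.mem_sdiff,
        Finset.mem_univ, true_and]; tauto
  omega

/-- A closed path at least as long as every locked path covers the smaller side. -/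
lemma hasCyc_of_cyc (S : Setting G A k l) {C : List V} (hC : Cyc G C)
    (hmax : ∀ p x y, Locked G A p x y → p.length ≤ C.length) : HasCyc G Aᶜ.card := by
  classical
  obtain ⟨a₀, b₀, hp₀, -⟩ := id hC
  have hne := hp₀.ne_nil
  have : Nonempty V := ⟨a₀⟩
  by_cases hM : 2 * Aᶜ.card ≤ C.length
  · exact hC.hasCyc_of_length S.two_le_card_compl hM
  exfalso
  have hcard := S.card_outside hC
  have hle := S.card_le
  set R : Finset V := Finset.univ.filter fun r => ∃ c ∈ C, G.Adj c r with hR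
  by_cases hb : ∃ b, b ∉ C ∧ b ∉ A ∧ ∃ c ∈ C, G.Adj c b
  · obtain ⟨b, hbC, hbA, c, hc, hcb⟩ := hb
    obtain ⟨q, z, x, hz, hq, hx, hqW, hlock⟩ := exists_locked_in S.bip _
      (Finset.univ \ C.toFinset) R rfl (by
        intro w hw
        obtain ⟨r, c, hc, p, hcr, hp, hpC⟩ := S.exists_pth_to hne (w := w) (by simpa using hw)
        exact ⟨r, by simpa [hR] using ⟨c, hc, hcr⟩, _, hp.reverse,
          fun v hv => by simpa using hpC v (by simpa using hv)⟩)
      (Or.inr ⟨by omega, b, by simpa [hR] using ⟨c, hc, hcb⟩, by simpa using hbC, hbA⟩)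
    obtain ⟨c', hc', hcz⟩ := (Finset.mem_filter.1 hz).2
    obtain ⟨C', d, hC', -, hlen, hmem⟩ := hC.rotate_last hc'
    have hP := hC'.append hq hcz (fun v hv hv' => by
      have := hqW v hv'
      simp only [Finset.mem_sdiff, Finset.mem_univ, List.mem_toFinset, true_and] at this
      exact this ((hmem v).1 hv))
    have := hmax _ _ _ ⟨hP.reverse, hx, fun v hv => by
      rw [List.mem_reverse, List.mem_append]
      by_cases hvC : v ∈ C
      · exact Or.inl ((hmem v).2 hvC)
      · exact Or.inr (hlock v (by simpa using hvC) hv)⟩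
    have h3 := List.length_pos_of_ne_nil hq.ne_nil
    simp only [List.length_reverse, List.length_append] at this
    omega
  · push Not at hb
    obtain ⟨w, hw⟩ : ((Finset.univ \ C.toFinset) \ A).Nonempty := Finset.card_pos.1 (by omega)
    have hwC : w ∉ C := by
      simpa using (Finset.mem_sdiff.1 hw).1
    obtain ⟨r, c, hc, p, hcr, hp, hpC⟩ := S.exists_pth_to hne hwC
    have hrC := hpC r hp.last_mem
    have hrA : r ∈ A := by
      by_contra h
      exact hb r hrC h c hc hcr
    obtain ⟨C', d, hC', hcd, hlen, hmem⟩ := hC.rotate_last hc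
    have hcA : c ∉ A := fun h => (S.bip _ _ hcr).1 h hrA
    have hdA : d ∈ A := by
      have := S.bip _ _ hcd
      tauto
    have := hmax _ _ _ ⟨hC'.concat hcr (fun h => hrC ((hmem r).1 h)), hdA, fun v hv => by
      refine List.mem_append_left _ ((hmem v).2 ?_)
      by_contra hvC
      exact hb v hvC ((S.bip _ _ hv).1 hdA) d ((hmem d).1 hC'.head_mem) hv⟩
    simp only [List.length_append, List.length_singleton] at this
    omega

/-- A longest locked path whose other end is locked on the other side. -/
lemma hasCyc_of_locked_opposite (S : Setting G A k l) {p : List V} {x y : V}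
    (hp : Locked G A p x y) (hy : y ∉ A) (hylock : ∀ v, G.Adj y v → v ∈ p)
    (hmax : ∀ p' x' y', Locked G A p' x' y' → p'.length ≤ p.length) :
    HasCyc G (min Aᶜ.card (k + l - 1)) := by
  obtain ⟨f, n, hf, rfl, rfl, hlen, rfl⟩ := hp.path.exists_pathFun
  by_cases hnc : ∀ i < n, G.Adj (f n) (f i) → ¬ G.Adj (f 0) (f (i + 1))
  · exact (hf.hasCyc_of_opposite S.bip S.conn2 hp.mem hy hp.lock hylock S.two_le_left
      S.two_le_right (S.deg_left _ hp.mem) (S.deg_right _ hy) hnc).mono (min_le_right _ _)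
  · push Not at hnc
    obtain ⟨i, hi, h1, h2⟩ := hnc
    refine (S.hasCyc_of_cyc (hf.cyc_of_cross (Nat.lt_succ_self i) hi h1 h2) ?_).mono
      (min_le_left _ _)
    intro p' x' y' h
    have := hmax _ _ _ h
    simp only [List.length_append, List.length_reverse, length_seg] at this ⊢
    omega

end Setting

end

section

variable {V : Type*} {G : SimpleGraph V}

/-- Rotating a closed path so that it starts at its vertex of index `u`. -/
lemma PathFun.rotate {F : ℕ → V} {m : ℕ} (hF : PathFun G F m) (hc : G.Adj (F m) (F 0)) {u : ℕ}
    (hu : u ≤ m) : ∃ F', PathFun G F' m ∧ G.Adj (F' m) (F' 0) ∧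
      (∀ v, v ∈ seg F' 0 m ↔ v ∈ seg F 0 m) ∧ (∀ i, i + u ≤ m → F' i = F (i + u)) ∧
      ∀ i ≤ m, m < i + u → F' i = F (i + u - (m + 1)) := by
  set F' : ℕ → V := fun i => if i + u ≤ m then F (i + u) else F (i + u - (m + 1)) with hF'
  have h1 : ∀ i, i + u ≤ m → F' i = F (i + u) := fun i hi => by simp [hF', hi]
  have h2 : ∀ i ≤ m, m < i + u → F' i = F (i + u - (m + 1)) := fun i _ hi => by
    simp [hF', Nat.not_le.2 hi]
  have hadj : ∀ i < m, G.Adj (F' i) (F' (i + 1)) := by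
    intro i hi
    by_cases h3 : i + 1 + u ≤ m
    · rw [h1 i (by omega), h1 (i + 1) h3, show i + 1 + u = i + u + 1 by omega]
      exact hF.adj _ (by omega)
    · rw [h2 (i + 1) (by omega) (by omega)]
      by_cases h4 : i + u ≤ m
      · rw [h1 i h4, show i + u = m by omega, show i + 1 + u - (m + 1) = 0 by omega]
        exact hc
      · rw [h2 i (by omega) (by omega),
          show i + 1 + u - (m + 1) = i + u - (m + 1) + 1 by omega]
        exact hF.adj _ (by omega)
  refine ⟨F', ⟨hadj, ?_⟩, ?_, ?_, h1, h2⟩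
  · intro i j hi hj hij
    by_cases h3 : i + u ≤ m <;> by_cases h4 : j + u ≤ m
    · rw [h1 i h3, h1 j h4] at hij
      have := hF.inj _ _ h3 h4 hij
      omega
    · rw [h1 i h3, h2 j hj (by omega)] at hij
      have := hF.inj _ _ h3 (by omega) hij
      omega
    · rw [h2 i hi (by omega), h1 j h4] at hij
      have := hF.inj _ _ (by omega) h4 hij
      omega
    · rw [h2 i hi (by omega), h2 j hj (by omega)] at hij
      have := hF.inj _ _ (by omega) (by omega) hij
      omega
  · rcases Nat.eq_zero_or_pos u with rfl | hu0
    · rw [h1 m (by omega), h1 0 (by omega)]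
      exact hc
    · rw [h2 m le_rfl (by omega), h1 0 (by omega), show m + u - (m + 1) = u - 1 by omega]
      have := hF.adj (u - 1) (by omega)
      rwa [show u - 1 + 1 = 0 + u by omega] at this
  · intro v
    rw [mem_seg, mem_seg]
    constructor
    · rintro ⟨i, -, hi, rfl⟩
      by_cases h3 : i + u ≤ m
      · exact ⟨i + u, by omega, h3, (h1 i h3).symm⟩
      · exact ⟨i + u - (m + 1), by omega, by omega, (h2 i hi (by omega)).symm⟩
    · rintro ⟨i, -, hi, rfl⟩
      by_cases h3 : u ≤ i
      · exact ⟨i - u, by omega, by omega, by rw [h1 _ (by omega)]; congr 1; omega⟩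
      · exact ⟨i + (m + 1) - u, by omega, by omega, by
          rw [h2 _ (by omega) (by omega)]; congr 1; omega⟩

variable [Fintype V] [DecidableEq V] {A : Finset V} {k l : ℕ}

namespace Setting

/-- The case of a path outside the closed path whose locked end has neighbours on both. -/
lemma hasCyc_of_attached (S : Setting G A k l) {C T : List V} {g b e : V} (hC : Cyc G C)
    (hgA : g ∈ A) (hgC : g ∉ C) (hg : ∀ v, G.Adj g v → v ∈ C)
    (hmax : ∀ p x y, Locked G A p x y → p.length ≤ C.length + 1) (hT : Pth G T b e)
    (hTC : ∀ v ∈ T, v ∉ C ∧ v ≠ g) (hbA : b ∉ A) (heA : e ∉ A)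
    (he : ∀ v, G.Adj e v → v ∈ C ∨ v ∈ T) {c : V} (hc : c ∈ C) (hec : G.Adj e c) :
    HasCyc G (k + l - 1) := by
  classical
  obtain ⟨a₀, b₀, hp₀, hba₀⟩ := id hC
  obtain ⟨F₀, m, hF₀, h0, h1, hlen, hseg⟩ := hp₀.exists_pathFun
  subst h0 h1
  have hmem₀ : ∀ v, v ∈ seg F₀ 0 m ↔ v ∈ C := fun v => by rw [hseg]
  have hkg := S.deg_left g hgA
  have hk2 := S.two_le_left
  have hl2 := S.two_le_right
  have hrot : ∀ v ∈ C, ∃ F, PathFun G F m ∧ G.Adj (F m) (F 0) ∧ (∀ v, v ∈ seg F 0 m ↔ v ∈ C) ∧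
      F 0 = v := by
    intro v hv
    obtain ⟨u, -, hu, rfl⟩ := mem_seg.1 ((hmem₀ v).2 hv)
    obtain ⟨F, hF, hFc, hFm, hF1, -⟩ := hF₀.rotate hba₀ hu
    exact ⟨F, hF, hFc, fun v => (hFm v).trans (hmem₀ v), by simpa using hF1 0 (by omega)⟩
  obtain ⟨q, ⟨F, hF, hFc, hFm, hg0, hq, heq⟩, hqmax⟩ := exists_max_of_bounded (m := m)
    (P := fun q => ∃ F, PathFun G F m ∧ G.Adj (F m) (F 0) ∧ (∀ v, v ∈ seg F 0 m ↔ v ∈ C) ∧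
      G.Adj g (F 0) ∧ q ≤ m ∧ G.Adj e (F q)) (by rintro q ⟨F, -, -, -, -, h, -⟩; exact h) (by
      obtain ⟨w, hw⟩ : (nb G g).Nonempty := Finset.card_pos.1 (by omega)
      rw [mem_nb] at hw
      obtain ⟨F, hF, hFc, hFm, h0⟩ := hrot w (hg w hw)
      obtain ⟨u, -, hu, rfl⟩ := mem_seg.1 ((hFm c).2 hc)
      exact ⟨u, F, hF, hFc, hFm, h0 ▸ hw, hu, hec⟩)
  -- no neighbour of `g` lies after `F q`
  have hgap : ∀ u, u ≤ m → G.Adj g (F u) → u ≤ q := by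
    intro u hu hadj
    by_contra! h
    obtain ⟨F', hF', hFc', hFm', hF1, hF2⟩ := hF.rotate hFc hu
    have h3 : F' (q + (m + 1) - u) = F q := by
      rw [hF2 _ (by omega) (by omega)]; congr 1; omega
    have := hqmax (q + (m + 1) - u) ⟨F', hF', hFc', fun v => (hFm' v).trans (hFm v), by
      rw [hF1 0 (by omega), Nat.zero_add]; exact hadj, by omega, by rw [h3]; exact heq⟩
    omega
  have hgap' : ∀ u, u ≤ m → G.Adj e (F u) → u ≤ q :=
    fun u hu hadj => hqmax u ⟨F, hF, hFc, hFm, hg0, hu, hadj⟩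
  have hF0A : F 0 ∈ (Aᶜ : Finset V) := by simpa using (S.bip _ _ hg0).1 hgA
  have par : ∀ u ≤ m, F u ∈ A ↔ u % 2 = 1 := by
    intro u hu
    have := hF.mem_iff S.bip.compl hF0A hu
    simp only [Finset.mem_compl] at this
    by_cases h : F u ∈ A <;> simp only [h, not_true, not_false_iff, false_iff, true_iff] at this ⊢
    · omega
    · omega
  have hmodd : m % 2 = 1 := by
    rw [← par m le_rfl]
    have := S.bip _ _ hFc
    simp only [Finset.mem_compl] at hF0A
    tauto
  have hqodd : q % 2 = 1 := by
    rw [← par q hq]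
    have := S.bip _ _ heq
    tauto
  have hTodd := hT.count S.bip
  simp only [hbA, heA, if_false] at hTodd
  -- the path from `g` along the closed path to `F q` and then through `T`
  have hseg : Pth G (seg F 0 q) (F 0) (F q) := hF.seg_pth (Nat.zero_le q) hq
  have hsegC : ∀ v ∈ seg F 0 q, v ∈ C := fun v hv => by
    obtain ⟨u, h1, h2, rfl⟩ := mem_seg.1 hv
    exact (hFm _).1 (apply_mem_seg h1 (by omega))
  have hlong := hmax _ _ _ ⟨(hseg.cons hg0 fun h => hgC (hsegC g h)).append hT.reverse heq.symm (by
    intro v hv hv'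
    rw [List.mem_reverse] at hv'
    rcases List.mem_cons.1 hv with rfl | hv
    · exact (hTC _ hv').2 rfl
    · exact (hTC v hv').1 (hsegC v hv)), hgA, fun v hv => by
      obtain ⟨u, -, h2, rfl⟩ := mem_seg.1 ((hFm v).2 (hg v hv))
      exact List.mem_append_left _ (List.mem_cons_of_mem _
        (apply_mem_seg (Nat.zero_le u) (hgap u h2 hv)))⟩
  simp only [List.length_append, List.length_cons, length_seg, List.length_reverse] at hlong
  have hgidx : (nb G g).card ≤ (nbIdx G F m g).card :=
    card_nb_le fun w hw => (hFm w).2 (hg w hw)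
  have heidx : l ≤ (nbIdx G F m e).card + (T.filter (· ∈ A)).length := by
    have h3 : nb G e ⊆ (nbIdx G F m e).image F ∪ (T.filter (· ∈ A)).toFinset := by
      intro w hw
      rw [mem_nb] at hw
      rw [Finset.mem_union]
      rcases he w hw with h | h
      · obtain ⟨u, -, h2, rfl⟩ := mem_seg.1 ((hFm w).2 h)
        exact Or.inl (Finset.mem_image.2 ⟨u, mem_nbIdx.2 ⟨h2, hw⟩, rfl⟩)
      · right
        have := S.bip _ _ hw
        simp only [List.mem_toFinset, List.mem_filter, decide_eq_true_eq]
        tauto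
    have h4 := (S.deg_right e heA).trans (Finset.card_le_card h3)
    have h5 := Finset.card_union_le ((nbIdx G F m e).image F) (T.filter (· ∈ A)).toFinset
    have h6 : ((nbIdx G F m e).image F).card ≤ _ := Finset.card_image_le
    have h7 := List.toFinset_card_le (T.filter (· ∈ A))
    omega
  have hE : ∀ u ∈ nbIdx G F m e, u % 2 = 1 ∧ u ≤ q := by
    intro u hu
    rw [mem_nbIdx] at hu
    refine ⟨(par u hu.1).1 ?_, hgap' u hu.1 hu.2⟩
    have := S.bip _ _ hu.2
    tauto
  have hN : ∀ u ∈ nbIdx G F m g, u % 2 = 0 ∧ u ≤ q := by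
    intro u hu
    rw [mem_nbIdx] at hu
    refine ⟨?_, hgap u hu.1 hu.2⟩
    have h3 := (S.bip _ _ hu.2).1 hgA
    rw [par u hu.1] at h3
    omega
  have h0mem : 0 ∈ nbIdx G F m g := mem_nbIdx.2 ⟨by omega, hg0⟩
  have hfin : (nbIdx G F m e ∪ ((nbIdx G F m g).erase 0).image (· - 1)) ⊆
      (Finset.range ((q + 1) / 2)).image (fun u => 2 * u + 1) := by
    intro u hu
    rw [Finset.mem_union, Finset.mem_image] at hu
    rw [Finset.mem_image]
    rcases hu with hu | ⟨u, hu, rfl⟩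
    · have := hE u hu
      exact ⟨u / 2, Finset.mem_range.2 (by omega), by omega⟩
    · rw [Finset.mem_erase] at hu
      have := hN u hu.2
      exact ⟨u / 2 - 1, Finset.mem_range.2 (by omega), by omega⟩
  have hcard := Finset.card_le_card hfin
  rw [Finset.card_union_of_disjoint] at hcard
  swap
  · rw [Finset.disjoint_left]
    intro u hu hu'
    obtain ⟨u', hu'', rfl⟩ := Finset.mem_image.1 hu'
    obtain ⟨h3, h4⟩ := Finset.mem_erase.1 hu''
    have h5 := hN u' h4
    rw [mem_nbIdx] at hu h4
    obtain ⟨F', hF', hFc', hFm', hF1, hF2⟩ := hF.rotate hFc h4.1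
    have h6 : F' m = F (u' - 1) := by
      rw [hF2 m le_rfl (by omega)]; congr 1; omega
    have := hqmax m ⟨F', hF', hFc', fun v => (hFm' v).trans (hFm v), by
      rw [hF1 0 (by omega), Nat.zero_add]; exact h4.2, le_rfl, by rw [h6]; exact hu.2⟩
    have h7 := List.length_pos_of_ne_nil hT.ne_nil
    omega
  rw [Finset.card_image_of_injOn (s := (nbIdx G F m g).erase 0), Finset.card_erase_of_mem h0mem]
    at hcard
  swap
  · intro x hx y hy hxy
    have h3 := (Finset.mem_erase.1 hx).1
    have h4 := (Finset.mem_erase.1 hy).1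
    simp only at hxy
    omega
  have h8 : ((Finset.range ((q + 1) / 2)).image (fun u => 2 * u + 1)).card ≤ _ :=
    Finset.card_image_le
  rw [Finset.card_range] at h8
  exact hC.hasCyc_of_length (by omega) (by omega)

/-- A closed path and a vertex `g` off it with all neighbours on it. -/
lemma hasCyc_of_cyc_add_one (S : Setting G A k l) {C : List V} {g : V} (hC : Cyc G C)
    (hgA : g ∈ A) (hgC : g ∉ C) (hg : ∀ v, G.Adj g v → v ∈ C)
    (hmax : ∀ p x y, Locked G A p x y → p.length ≤ C.length + 1) :
    HasCyc G (min Aᶜ.card (k + l - 1)) := by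
  classical
  obtain ⟨a₀, b₀, hp₀, hba₀⟩ := id hC
  have hne := hp₀.ne_nil
  have : Nonempty V := ⟨a₀⟩
  have hk2 := S.two_le_left
  by_cases hM : 2 * Aᶜ.card ≤ C.length
  · exact (hC.hasCyc_of_length S.two_le_card_compl hM).mono (min_le_left _ _)
  by_cases hb : ∃ b, b ∉ C ∧ b ∉ A ∧ ∃ c ∈ C, G.Adj c b
  · refine HasCyc.mono ?_ (min_le_right _ _)
    obtain ⟨b, hbC, hbA, c, hc, hcb⟩ := hb
    obtain ⟨T, ⟨e, hT, hTC⟩, hTmax⟩ := exists_longest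
      (P := fun T => ∃ e, Pth G T b e ∧ ∀ v ∈ T, v ∉ C ∧ v ≠ g) (fun T hT => hT.choose_spec.1.nodup)
      ⟨[b], b, Pth.singleton b, by
        intro v hv
        simp only [List.mem_singleton] at hv
        subst hv
        exact ⟨hbC, fun h => hbA (h ▸ hgA)⟩⟩
    have heC := (hTC e hT.last_mem).1
    have he : ∀ v, G.Adj e v → v ∈ C ∨ v ∈ T := by
      intro v hv
      by_contra! h
      have := hTmax (T ++ [v]) ⟨v, hT.concat hv h.2, by
        intro w hw
        simp only [List.mem_append, List.mem_singleton] at hw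
        rcases hw with hw | rfl
        · exact hTC w hw
        · refine ⟨h.1, ?_⟩
          rintro rfl
          exact heC (hg e hv.symm)⟩
      simp at this
    obtain ⟨C', d, hC', hcd, hlen, hmem⟩ := hC.rotate_last hc
    by_cases heA : e ∈ A
    · exfalso
      have hP := hC'.append hT hcb (fun v hv hv' => (hTC v hv').1 ((hmem v).1 hv))
      have h3 := hmax _ _ _ ⟨hP.reverse, heA, fun v hv => by
        rw [List.mem_reverse, List.mem_append, hmem]
        exact he v hv⟩
      have h4 := hT.count S.bip
      simp only [hbA, heA, if_false, if_true] at h4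
      have h5 := List.length_pos_of_ne_nil hT.ne_nil
      simp only [List.length_reverse, List.length_append] at h3
      omega
    by_cases hE : ∃ c ∈ C, G.Adj e c
    · obtain ⟨c', hc', hec⟩ := hE
      exact S.hasCyc_of_attached hC hgA hgC hg hmax hT hTC hbA heA he hc' hec
    push Not at hE
    have heT : ∀ v, G.Adj e v → v ∈ T := fun v hv => (he v hv).resolve_left fun h => hE v h hv
    obtain ⟨F, m, hF, hF0, hFm, -, hseg⟩ := hC'.exists_pathFun
    have hmem' : ∀ v, v ∈ seg F 0 m ↔ v ∈ C := fun v => by rw [hseg, hmem]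
    have hex : ∃ u, u ≤ m ∧ G.Adj g (F u) := by
      obtain ⟨w, hw⟩ : (nb G g).Nonempty :=
        Finset.card_pos.1 (by have := S.deg_left g hgA; omega)
      rw [mem_nb] at hw
      obtain ⟨u, -, hu, rfl⟩ := mem_seg.1 ((hmem' w).2 (hg w hw))
      exact ⟨u, hu, hw⟩
    obtain ⟨hu, hgu⟩ := Nat.find_spec hex
    have humin : ∀ u', u' ≤ m → G.Adj g (F u') → Nat.find hex ≤ u' :=
      fun u' h1 h2 => Nat.find_min' hex ⟨h1, h2⟩
    generalize Nat.find hex = u at *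
    have hsegC : ∀ v ∈ seg F u m, v ∈ C := fun v hv => by
      obtain ⟨w, h1, h2, rfl⟩ := mem_seg.1 hv
      exact (hmem' _).1 (apply_mem_seg (Nat.zero_le w) h2)
    have hP := ((hF.seg_pth hu le_rfl).cons hgu (fun h => hgC (hsegC g h))).append hT
      (hFm ▸ hcb) (by
        intro v hv hv'
        rcases List.mem_cons.1 hv with rfl | hv
        · exact (hTC _ hv').2 rfl
        · exact (hTC v hv').1 (hsegC v hv))
    have hgl : ∀ w, G.Adj g w → w ∈ seg F u m := by
      intro w hw
      obtain ⟨u', -, hu', rfl⟩ := mem_seg.1 ((hmem' w).2 (hg w hw))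
      exact apply_mem_seg (humin u' hu' hw) hu'
    obtain ⟨f, n, hf, hf0, hfn, hflen, hfseg⟩ := hP.exists_pathFun
    have hlenT : ∀ i ≤ n, f i ∈ T → ∀ j ≤ n, i ≤ j → f j ∈ T := by
      intro i hi hiT j hj hij
      have hget : ∀ i ≤ n, (g :: seg F u m ++ T)[i]? = some (f i) := by
        intro i hi
        rw [← hfseg]
        simp [seg, hi]
      set L := g :: seg F u m with hL
      have h3 : L.length ≤ i := by
        by_contra! h
        have h4 := hget i hi
        rw [List.getElem?_append_left h] at h4
        have h5 := List.mem_of_getElem? h4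
        have h6 := (List.nodup_append.1 hP.nodup).2.2
        exact h6 _ h5 _ hiT rfl
      have h4 := hget j hj
      rw [List.getElem?_append_right (by omega)] at h4
      exact List.mem_of_getElem? h4
    refine hf.hasCyc_of_opposite S.bip S.conn2 (hf0 ▸ hgA) (hfn ▸ heA) ?_ ?_ hk2 S.two_le_right
      (S.deg_left _ (hf0 ▸ hgA)) (S.deg_right _ (hfn ▸ heA)) ?_
    · intro w hw
      rw [hf0] at hw
      rw [hfseg]
      exact List.mem_append_left _ (List.mem_cons_of_mem _ (hgl w hw))
    · intro w hw
      rw [hfn] at hw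
      rw [hfseg]
      exact List.mem_append_right _ (heT w hw)
    · intro i hi h1 h2
      rw [hfn] at h1
      rw [hf0] at h2
      exact (hTC _ (hlenT i hi.le (heT _ h1) (i + 1) hi (by omega))).1 (hg _ h2)
  · exfalso
    push Not at hb
    have hcard := S.card_outside hC
    obtain ⟨w, hw⟩ : ((Finset.univ \ C.toFinset) \ A).Nonempty := Finset.card_pos.1 (by omega)
    rw [Finset.mem_sdiff] at hw
    have hwC : w ∉ C := by simpa using hw.1
    obtain ⟨r, c, hc, p, hcr, hp, hpC⟩ := S.exists_pth_to hne hwC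
    have hrC := hpC r hp.last_mem
    have hrA : r ∈ A := by
      by_contra h
      exact hb r hrC h c hc hcr
    have hwr : w ≠ r := fun h => hw.2 (h ▸ hrA)
    obtain ⟨p', s, rfl, hp', hsr, hrp⟩ := hp.exists_pred hwr
    have hsC : s ∉ C := hpC s (List.mem_append_left _ hp'.last_mem)
    obtain ⟨C', d, hC', hcd, hlen, hmem⟩ := hC.rotate_last hc
    have hcA : c ∉ A := fun h => (S.bip _ _ hcr).1 h hrA
    have hdA : d ∈ A := by
      have := S.bip _ _ hcd
      tauto
    have := hmax _ _ _ ⟨(hC'.concat hcr (fun h => hrC ((hmem r).1 h))).concat hsr.symm (by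
      rw [List.mem_append, List.mem_singleton, hmem]
      rintro (h | h)
      · exact hsC h
      · exact hsr.ne h), hdA, fun v hv => by
      refine List.mem_append_left _ (List.mem_append_left _ ((hmem v).2 ?_))
      by_contra hvC
      exact hb v hvC ((S.bip _ _ hv).1 hdA) d ((hmem d).1 hC'.head_mem) hv⟩
    simp only [List.length_append, List.length_singleton] at this
    omega

/-- A longest locked path with both ends in `A`, locked, which see two vertices of the path
at distance two. -/
lemma hasCyc_of_adjacent_cross (S : Setting G A k l) {f : ℕ → V} {n i : ℕ} (hf : PathFun G f n)
    (h0 : f 0 ∈ A) (hn : f n ∈ A) (hln : ∀ w, G.Adj (f n) w → w ∈ seg f 0 n)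
    (hmax : ∀ p x y, Locked G A p x y → p.length ≤ n + 1) (hi : i + 2 ≤ n)
    (hi0 : G.Adj (f 0) (f (i + 2))) (hin : G.Adj (f n) (f i)) :
    HasCyc G (min Aᶜ.card (k + l - 1)) := by
  have hpar : (i + 2) % 2 ≠ 0 := fun h => by
    have := (hf.mem_iff S.bip h0 hi).2 h
    exact (S.bip _ _ hi0).1 h0 this
  have hgA : f (i + 1) ∈ A := (hf.mem_iff S.bip h0 (by omega)).2 (by omega)
  have hC := hf.cyc_of_cross (by omega) hi hin hi0
  have hlen : (seg f 0 i ++ (seg f (i + 2) n).reverse).length + 1 = n + 1 := by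
    simp only [List.length_append, List.length_reverse, length_seg]
    omega
  have hmemC : ∀ v, v ∈ seg f 0 n → v ≠ f (i + 1) → v ∈ seg f 0 i ++ (seg f (i + 2) n).reverse := by
    intro v hv hne
    obtain ⟨u, -, hu, rfl⟩ := mem_seg.1 hv
    have : u ≠ i + 1 := fun h => hne (by rw [h])
    exact PathFun.mem_cross hu (by omega)
  refine S.hasCyc_of_cyc_add_one hC hgA ?_ ?_ (fun p x y hp => by rw [hlen]; exact hmax p x y hp)
  · rw [List.mem_append, List.mem_reverse]
    rintro (h | h)
    · exact hf.seg_disjoint (Nat.lt_succ_self i) (j' := i + 1) (by omega) _ h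
        (apply_mem_seg le_rfl le_rfl)
    · exact hf.seg_disjoint (i := i + 1) (Nat.lt_succ_self (i + 1)) le_rfl _
        (apply_mem_seg le_rfl le_rfl) h
  · intro v hv
    refine hmemC v ?_ hv.ne'
    by_contra hvn
    have hP := (hf.seg_pth (Nat.zero_le (i + 1)) (by omega)).reverse.append
      (hf.seg_pth hi le_rfl) hi0
      (fun v hv hv' => hf.seg_disjoint (Nat.lt_succ_self (i + 1)) le_rfl v (by simpa using hv) hv')
    have hPm : ∀ w, w ∈ (seg f 0 (i + 1)).reverse ++ seg f (i + 2) n ↔ w ∈ seg f 0 n := by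
      intro w
      rw [List.mem_append, List.mem_reverse, mem_seg, mem_seg, mem_seg]
      constructor
      · rintro (⟨u, h1, h2, rfl⟩ | ⟨u, h1, h2, rfl⟩)
        · exact ⟨u, h1, by omega, rfl⟩
        · exact ⟨u, by omega, h2, rfl⟩
      · rintro ⟨u, h1, h2, rfl⟩
        by_cases h : u ≤ i + 1
        · exact Or.inl ⟨u, h1, h, rfl⟩
        · exact Or.inr ⟨u, by omega, h2, rfl⟩
    have hP' := hP.cons hv.symm (fun h => hvn ((hPm v).1 h))
    have := hmax _ _ _ ⟨hP'.reverse, hn, fun w hw => by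
      rw [List.mem_reverse]
      exact List.mem_cons_of_mem _ ((hPm w).2 (hln w hw))⟩
    simp only [List.length_reverse, List.length_cons, List.length_append, length_seg] at this
    omega

end Setting

end

section

/-- For two sets of indices, a closest pair `t < s` with `t` in the second and `s` in the first
set leaves few indices between. -/
lemma exists_closest_pair {M N : Finset ℕ} {m k : ℕ} (hM : ∀ u ∈ M, u < m) (hN : ∀ u ∈ N, u < m)
    (hkM : k ≤ M.card) (hkN : k ≤ N.card) (hMN : ∀ u ∈ N, u + 1 ∉ M)
    (hex : ∃ t ∈ N, ∃ s ∈ M, t < s) : ∃ t ∈ N, ∃ s ∈ M, t < s ∧ 2 * k - 2 ≤ t + 1 + (m - s) ∧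
      (t + 1 + (m - s) ≤ 2 * k - 2 → ∀ u < m, u ≤ t ∨ s ≤ u + 1 → u ∈ N ∨ u + 1 ∈ M) := by
  classical
  have hcr : ∃ d, ∃ t ∈ N, ∃ s ∈ M, t < s ∧ s - t = d := by
    obtain ⟨t, ht, s, hs, hts⟩ := hex
    exact ⟨_, t, ht, s, hs, hts, rfl⟩
  obtain ⟨t, ht, s, hs, hts, hd⟩ := Nat.find_spec hcr
  have hmin : ∀ t' ∈ N, ∀ s' ∈ M, t' < s' → s - t ≤ s' - t' := by
    intro t' h1 s' h2 h3
    rw [hd]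
    exact Nat.find_min' hcr ⟨t', h1, s', h2, h3, rfl⟩
  set T := ((M.erase s).erase 0).image (· - 1) ∪ N with hT
  have hsub : T ⊆ Finset.range (t + 1) ∪ Finset.Ico s m := by
    intro u hu
    rw [Finset.mem_union, Finset.mem_range, Finset.mem_Ico]
    rw [hT, Finset.mem_union, Finset.mem_image] at hu
    rcases hu with ⟨u, hu, rfl⟩ | hu
    · simp only [Finset.mem_erase] at hu
      have h1 := hM u hu.2.2
      have h2 := hmin t ht u hu.2.2
      omega
    · have h1 := hN u hu
      have h2 := hmin u hu s hs
      omega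
  have hcardT : 2 * k - 2 ≤ T.card := by
    rw [hT, Finset.card_union_of_disjoint, Finset.card_image_of_injOn]
    · have h1 := Finset.pred_card_le_card_erase (s := M.erase s) (a := 0)
      rw [Finset.card_erase_of_mem hs] at h1
      omega
    · intro a ha b hb hab
      have h3 := (Finset.mem_erase.1 ha).1
      have h4 := (Finset.mem_erase.1 hb).1
      simp only at hab
      omega
    · rw [Finset.disjoint_left]
      intro u hu hu'
      obtain ⟨u', hu'', rfl⟩ := Finset.mem_image.1 hu
      simp only [Finset.mem_erase] at hu''
      refine hMN _ hu' ?_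
      rw [show u' - 1 + 1 = u' by omega]
      exact hu''.2.2
  have hcardR : (Finset.range (t + 1) ∪ Finset.Ico s m).card = t + 1 + (m - s) := by
    rw [Finset.card_union_of_disjoint, Finset.card_range, Nat.card_Ico]
    rw [Finset.disjoint_left]
    intro u
    simp only [Finset.mem_range, Finset.mem_Ico]
    omega
  have hle := Finset.card_le_card hsub
  refine ⟨t, ht, s, hs, hts, by omega, fun htight u hu hu' => ?_⟩
  by_cases hsu : u + 1 = s
  · exact Or.inr (hsu ▸ hs)
  have heq := Finset.eq_of_subset_of_card_le hsub (by omega)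
  have hmem : u ∈ T := by
    rw [heq, Finset.mem_union, Finset.mem_range, Finset.mem_Ico]
    omega
  rw [hT, Finset.mem_union, Finset.mem_image] at hmem
  rcases hmem with ⟨w, hw, rfl⟩ | hu
  · simp only [Finset.mem_erase] at hw
    right
    rw [show w - 1 + 1 = w by omega]
    exact hw.2.2
  · exact Or.inl hu

variable {V : Type*} {G : SimpleGraph V}

/-- The `u < m` such that `x` is adjacent to `f (2 * u + 1)`. -/
noncomputable def oddIdx (G : SimpleGraph V) (f : ℕ → V) (m : ℕ) (x : V) : Finset ℕ := by
  classical exact (Finset.range m).filter fun u => G.Adj x (f (2 * u + 1))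

lemma mem_oddIdx {f : ℕ → V} {m : ℕ} {x : V} {u : ℕ} :
    u ∈ oddIdx G f m x ↔ u < m ∧ G.Adj x (f (2 * u + 1)) := by simp [oddIdx]

namespace PathFun

variable {f : ℕ → V} {m : ℕ} {A : Finset V}

lemma card_nb_le_oddIdx [Fintype V] [DecidableEq V] (hA : Bip G A) (hf : PathFun G f (2 * m))
    (h0 : f 0 ∈ A) {x : V} (hx : x ∈ A) (h : ∀ w, G.Adj x w → w ∈ seg f 0 (2 * m)) :
    (nb G x).card ≤ (oddIdx G f m x).card := by
  refine (Finset.card_le_card (t := (oddIdx G f m x).image fun u => f (2 * u + 1))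
    fun w hw => ?_).trans Finset.card_image_le
  rw [mem_nb] at hw
  obtain ⟨i, -, hi, rfl⟩ := mem_seg.1 (h w hw)
  have h1 := (hA _ _ hw).1 hx
  rw [hf.mem_iff hA h0 hi] at h1
  have h2 : 2 * (i / 2) + 1 = i := by omega
  exact Finset.mem_image.2 ⟨i / 2, mem_oddIdx.2 ⟨by omega, by rw [h2]; exact hw⟩, by rw [h2]⟩

lemma hasCyc_of_cross [DecidableEq V] (hA : Bip G A) (hf : PathFun G f (2 * m)) (h0 : f 0 ∈ A)
    {s t : ℕ} (hts : t < s) (hs : s ∈ oddIdx G f m (f 0)) (ht : t ∈ oddIdx G f m (f (2 * m))) :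
    HasCyc G (t + 1 + (m - s)) := by
  rw [mem_oddIdx] at hs ht
  refine hf.hasCyc hA (hf.cyc_of_cross (i := 2 * t + 1) (j := 2 * s + 1) (by omega) (by omega)
    ht.2 hs.2) ((Finset.range (t + 1) ∪ Finset.Ioc s m).image (2 * ·)) ?_ (by omega) ?_
  · intro i hi
    obtain ⟨u, hu, rfl⟩ := Finset.mem_image.1 hi
    rw [Finset.mem_union, Finset.mem_range, Finset.mem_Ioc] at hu
    have h1 : 2 * u ≤ 2 * m := by omega
    exact ⟨h1, (hf.mem_iff hA h0 h1).2 (by omega), mem_cross h1 (by omega)⟩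
  · rw [Finset.card_image_of_injOn (fun a _ b _ hab => by omega),
      Finset.card_union_of_disjoint, Finset.card_range, Nat.card_Ioc]
    rw [Finset.disjoint_left]
    intro u
    simp only [Finset.mem_range, Finset.mem_Ioc]
    omega

lemma hasCyc_of_not_cross [Fintype V] [DecidableEq V] (hA : Bip G A) (hG : Conn2 G)
    (hf : PathFun G f (2 * m)) (h0 : f 0 ∈ A) {k : ℕ} (hk : 2 ≤ k)
    (hk0 : k ≤ (oddIdx G f m (f 0)).card) (hkm : k ≤ (oddIdx G f m (f (2 * m))).card)
    (hno : ∀ t ∈ oddIdx G f m (f (2 * m)), ∀ s ∈ oddIdx G f m (f 0), s ≤ t) :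
    HasCyc G (2 * k - 1) := by
  have hm : f (2 * m) ∈ A := (hf.mem_iff hA h0 le_rfl).2 (by omega)
  have hodd : ∀ x ∈ A, ∀ i ≤ 2 * m, G.Adj x (f i) → ∃ u ∈ oddIdx G f m x, i = 2 * u + 1 := by
    intro x hx i hi hadj
    have h1 := (hA _ _ hadj).1 hx
    rw [hf.mem_iff hA h0 hi] at h1
    have h2 : i = 2 * (i / 2) + 1 := by omega
    exact ⟨i / 2, mem_oddIdx.2 ⟨by omega, by rw [← h2]; exact hadj⟩, h2⟩
  have hne0 : (oddIdx G f m (f 0)).Nonempty := Finset.card_pos.1 (by omega)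
  have hnem : (oddIdx G f m (f (2 * m))).Nonempty := Finset.card_pos.1 (by omega)
  have hs := Finset.max'_mem _ hne0
  have ht := Finset.min'_mem _ hnem
  have hst := hno _ ht _ hs
  have hsm := mem_oddIdx.1 hs
  have htm := mem_oddIdx.1 ht
  obtain ⟨C, j, hC, -, -, h1, h2⟩ := hf.exists_cyc_of_noncross hG
    (s := 2 * (oddIdx G f m (f 0)).max' hne0 + 1)
    (t := 2 * (oddIdx G f m (f (2 * m))).min' hnem + 1)
    (by omega) (by omega) hsm.2 htm.2 (by
      intro i hi hadj
      obtain ⟨u, hu, rfl⟩ := hodd _ h0 i hi hadj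
      have := Finset.le_max' _ _ hu
      omega) (by
      intro i hi hadj
      obtain ⟨u, hu, rfl⟩ := hodd _ hm i hi hadj
      have := Finset.min'_le _ _ hu
      omega)
  refine hf.hasCyc hA.compl hC
    ((oddIdx G f m (f 0) ∪ oddIdx G f m (f (2 * m))).image fun u => 2 * u + 1) ?_ (by omega) ?_
  · intro i hi
    obtain ⟨u, hu, rfl⟩ := Finset.mem_image.1 hi
    rw [Finset.mem_union, mem_oddIdx, mem_oddIdx] at hu
    have h3 : 2 * u + 1 ≤ 2 * m := by omega
    refine ⟨h3, ?_, ?_⟩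
    · rw [Finset.mem_compl, hf.mem_iff hA h0 h3]
      omega
    · rcases hu with hu | hu
      · exact (h1 _ h3 hu.2).1
      · exact h2 _ h3 hu.2
  · rw [Finset.card_image_of_injOn (fun a _ b _ hab => by omega)]
    have h3 := Finset.card_union_add_card_inter (oddIdx G f m (f 0)) (oddIdx G f m (f (2 * m)))
    have h4 : (oddIdx G f m (f 0) ∩ oddIdx G f m (f (2 * m))).card ≤ 1 := by
      rw [Finset.card_le_one]
      intro a ha b hb
      rw [Finset.mem_inter] at ha hb
      have h5 := hno a ha.2 b hb.1
      have h6 := hno b hb.2 a ha.1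
      omega
    omega

end PathFun

variable [Fintype V] [DecidableEq V] {A : Finset V} {k l : ℕ}

namespace Setting

lemma exists_locked (S : Setting G A k l) [Nonempty V] : ∃ p x y, Locked G A p x y := by
  have hpos := Fintype.card_pos (α := V)
  have h1 : A.card + Aᶜ.card = Fintype.card V := Finset.card_add_card_compl A
  obtain ⟨b, hb⟩ : Aᶜ.Nonempty := Finset.card_pos.1 (by have := S.two_le_card_compl; omega)
  obtain ⟨p, z, x, -, hp, hx, -, hlock⟩ := exists_locked_in S.bip _ Finset.univ Finset.univ rfl
    (fun w _ => ⟨w, Finset.mem_univ _, _, Pth.singleton w, by simp⟩)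
    (Or.inr ⟨by simpa [← Finset.compl_eq_univ_sdiff] using S.card_le, b, by simp, by simp,
      by simpa using hb⟩)
  exact ⟨_, _, _, hp.reverse, hx, fun v hv => by simpa using hlock v (by simp) hv⟩

/-- The first bound on the circumference. -/
theorem hasCyc_min (S : Setting G A k l) [Nonempty V] :
    HasCyc G (min Aᶜ.card (min (k + l - 1) (2 * k - 2))) := by
  have hk2 := S.two_le_left
  obtain ⟨p₀, x₀, y₀, hp₀⟩ := S.exists_locked
  obtain ⟨p, ⟨x, y, hp⟩, hmax⟩ := exists_longest (P := fun p => ∃ x y, Locked G A p x y)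
    (fun p hp => hp.choose_spec.choose_spec.path.nodup) ⟨p₀, x₀, y₀, hp₀⟩
  have hmax' : ∀ p' x' y', Locked G A p' x' y' → p'.length ≤ p.length :=
    fun p' x' y' h => hmax p' ⟨x', y', h⟩
  have hylock : ∀ v, G.Adj y v → v ∈ p := by
    intro v hv
    by_contra hvp
    have := hmax' _ _ _ ⟨hp.path.concat hv hvp, hp.mem, fun w hw =>
      List.mem_append_left _ (hp.lock w hw)⟩
    simp at this
  by_cases hy : y ∈ A
  swap
  · exact (S.hasCyc_of_locked_opposite hp hy hylock hmax').mono (by omega)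
  obtain ⟨f, n, hf, rfl, rfl, hlen, rfl⟩ := hp.path.exists_pathFun
  have h0 := hp.mem
  obtain ⟨m, rfl⟩ : ∃ m, n = 2 * m := by
    have := (hf.mem_iff S.bip h0 le_rfl).1 hy
    exact ⟨n / 2, by omega⟩
  have hk0 := (S.deg_left _ h0).trans (hf.card_nb_le_oddIdx S.bip h0 h0 hp.lock)
  have hkm := (S.deg_left _ hy).trans (hf.card_nb_le_oddIdx S.bip h0 hy hylock)
  by_cases hadj : ∃ u ∈ oddIdx G f m (f (2 * m)), u + 1 ∈ oddIdx G f m (f 0)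
  · obtain ⟨u, hu, hu'⟩ := hadj
    rw [mem_oddIdx] at hu hu'
    exact (S.hasCyc_of_adjacent_cross hf h0 hy hylock (by rwa [hlen] at hmax') (i := 2 * u + 1)
      (by omega) hu'.2 hu.2).mono (by omega)
  push Not at hadj
  by_cases hcr : ∃ t ∈ oddIdx G f m (f (2 * m)), ∃ s ∈ oddIdx G f m (f 0), t < s
  · obtain ⟨t, ht, s, hs, hts, hle, -⟩ := exists_closest_pair
      (fun u hu => (mem_oddIdx.1 hu).1) (fun u hu => (mem_oddIdx.1 hu).1) hk0 hkm hadj hcr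
    exact (hf.hasCyc_of_cross S.bip h0 hts hs ht).mono (by omega)
  · push Not at hcr
    exact (hf.hasCyc_of_not_cross S.bip S.conn2 h0 hk2 hk0 hkm hcr).mono (by omega)

end Setting

end

section

variable {V : Type*} {G : SimpleGraph V}

/-- Between two vertices of a closed path there is an arc with half of the vertices of `A`. -/
lemma Cyc.exists_arc [DecidableEq V] (A : Finset V) {C : List V} (hC : Cyc G C) {b c : V}
    (hb : b ∈ C) (hc : c ∈ C) (hbc : b ≠ c) : ∃ L, Pth G L b c ∧ (∀ v ∈ L, v ∈ C) ∧
      (C.toFinset ∩ A).card ≤ 2 * (L.toFinset ∩ A).card := by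
  obtain ⟨C', d, hC', hcd, -, hmem⟩ := hC.rotate_last hc
  obtain ⟨l₁, l₂, rfl⟩ := List.append_of_mem ((hmem b).2 hb)
  have h1 := hC'.right_of_append
  have h2 := hC'.left_of_append
  have hcl : c ∉ l₁ ++ [b] := by
    intro h
    rw [List.mem_append, List.mem_singleton] at h
    rcases h with h | h
    · exact (List.nodup_append.1 hC'.nodup).2.2 c h c h1.last_mem rfl
    · exact hbc h.symm
  have h3 := (h2.cons hcd hcl).reverse
  have hcard : (C.toFinset ∩ A).card ≤ ((b :: l₂).toFinset ∩ A).card +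
      ((c :: (l₁ ++ [b])).reverse.toFinset ∩ A).card := by
    refine (Finset.card_le_card fun v hv => ?_).trans (Finset.card_union_le _ _)
    rw [Finset.mem_inter, List.mem_toFinset, ← hmem v] at hv
    simp only [List.mem_append, List.mem_cons] at hv
    simp only [Finset.mem_union, Finset.mem_inter, List.mem_toFinset, List.mem_reverse,
      List.mem_cons, List.mem_append]
    tauto
  by_cases h : (C.toFinset ∩ A).card ≤ 2 * ((b :: l₂).toFinset ∩ A).card
  · exact ⟨_, h1, fun v hv => (hmem v).1 (List.mem_append_right _ hv), h⟩
  · refine ⟨_, h3, fun v hv => (hmem v).1 ?_, by omega⟩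
    have := h1.last_mem
    simp only [List.mem_reverse, List.mem_cons, List.mem_append, List.not_mem_nil,
      or_false] at hv this ⊢
    rcases hv with rfl | hv | hv
    · exact Or.inr this
    · exact Or.inl hv
    · exact Or.inr (Or.inl hv)

/-- A closed path together with a vertex `x` seeing only a path from `x` to the closed path. -/
lemma hasCyc_of_tail [Fintype V] [DecidableEq V] {A : Finset V} {k : ℕ} (hA : Bip G A)
    (hG : Conn2 G) (hk : 2 ≤ k) {C p : List V} {x c : V} (hC : Cyc G C)
    (hlen : 4 * k - 4 ≤ C.length) (hp : Pth G p x c) (hc : c ∈ C) (hpC : ∀ v ∈ p, v ∈ C → v = c)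
    (hx : x ∉ A) (hxp : ∀ v, G.Adj x v → v ∈ p ∧ v ∉ C) (hdeg : k ≤ (nb G x).card) :
    HasCyc G (2 * k - 1) := by
  obtain ⟨f, n, hf, rfl, rfl, -, rfl⟩ := hp.exists_pathFun
  have hne : (nbIdx G f n (f 0)).Nonempty := Finset.card_pos.1
    (by have := card_nb_le fun w hw => (hxp w hw).1; omega)
  obtain ⟨s, hs, hsmax⟩ : ∃ s, s ∈ nbIdx G f n (f 0) ∧ ∀ i ∈ nbIdx G f n (f 0), i ≤ s :=
    ⟨_, Finset.max'_mem _ hne, fun i hi => Finset.le_max' _ _ hi⟩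
  rw [mem_nbIdx] at hs
  have hs1 : 0 < s := by
    rcases Nat.eq_zero_or_pos s with h | h
    · subst h; exact absurd hs.2 (G.loopless.irrefl _)
    · exact h
  have hsn : s < n := by
    refine lt_of_le_of_ne hs.1 fun h => (hxp _ hs.2).2 (h ▸ hc)
  set X : Set V := {v | v ∈ seg f 0 s} with hX
  set Y : Set V := {v | v ∈ C} with hY
  have hXY : ∀ v, v ∈ X → v ∈ Y → False := by
    intro v hv hv'
    obtain ⟨u, h1, h2, rfl⟩ := mem_seg.1 hv
    have := hf.inj _ _ (by omega) le_rfl (hpC _ (apply_mem_seg h1 (by omega)) hv')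
    omega
  have hX2 : ∀ v, ∃ a ∈ X, a ≠ v := by
    intro v
    by_cases h : f 0 = v
    · refine ⟨f 1, apply_mem_seg (by omega) (by omega), fun h' => ?_⟩
      have := hf.inj 0 1 (by omega) (by omega) (h.trans h'.symm)
      omega
    · exact ⟨f 0, apply_mem_seg (by omega) (by omega), h⟩
  have hY2 : ∀ v, ∃ a ∈ Y, a ≠ v := by
    intro v
    obtain ⟨a, b, hab, hba⟩ := id hC
    by_cases h : a = v
    · exact ⟨b, hab.last_mem, fun h' => hba.ne (h'.trans h.symm)⟩
    · exact ⟨a, hab.head_mem, h⟩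
  have hq : Link G X Y (seg f s n) (f s) (f n) := by
    refine ⟨hf.seg_pth hsn.le le_rfl, apply_mem_seg (by omega) le_rfl, hc, ?_, ?_⟩
    · intro v hv hv'
      obtain ⟨u, h1, h2, rfl⟩ := mem_seg.1 hv
      obtain ⟨w, h3, h4, h5⟩ := mem_seg.1 hv'
      have := hf.inj _ _ (by omega) (by omega) h5
      congr 1; omega
    · intro v hv hv'
      obtain ⟨u, h1, h2, rfl⟩ := mem_seg.1 hv
      exact hpC _ (apply_mem_seg (by omega) h2) hv'
  have hXpath : ∀ x ∈ X, x ≠ f s → ∃ L, Pth G L x (f s) ∧ (∀ v ∈ L, v ∈ X) ∧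
      ∀ v, G.Adj (f 0) v → v ∈ L := by
    intro x hx hxs
    obtain ⟨r, h1, h2, rfl⟩ := mem_seg.1 hx
    have h3 : r ≠ s := fun h => hxs (h ▸ rfl)
    obtain ⟨L, j, hL, -, -, hLs, hL2⟩ := hf.exists_pth_collecting (p := r) (s := s) (by omega)
      hs.1 hs.2
    refine ⟨L, hL, hLs, fun v hv => ?_⟩
    obtain ⟨u, -, h4, rfl⟩ := mem_seg.1 (hxp v hv).1
    exact (hL2 u (hsmax u (mem_nbIdx.2 ⟨h4, hv⟩)) hv).1
  obtain ⟨W₁, W₂, a₁, a₂, b₂, h1, h2, hd, hs'⟩ := exists_disjoint_links hG hX2 _ rfl hY2 hq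
  have hb : b₂ ≠ f n := fun h => hd _ h1.path.last_mem (h ▸ h2.path.last_mem)
  have haa : a₁ ≠ a₂ := fun h => hd _ h1.path.head_mem (h ▸ h2.path.head_mem)
  obtain ⟨L', hL', hLY, hcard⟩ := hC.exists_arc A h2.right hc hb
  have hhalf := (hC.card_inter hA).1
  have finish : ∀ {L l : List V}, Cyc G l → (∀ v, G.Adj (f 0) v → v ∈ L) →
      (∀ v, v ∈ L ∨ v ∈ L' → v ∈ l) → HasCyc G (2 * k - 1) := by
    intro L l hl hL hm
    refine hl.hasCyc hA (S := nb G (f 0) ∪ L'.toFinset ∩ A) ?_ ?_ (by omega) ?_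
    · refine Finset.union_subset (fun v hv => ?_) Finset.inter_subset_right
      have := hA _ _ (mem_nb.1 hv)
      tauto
    · intro v hv
      rw [Finset.mem_union, mem_nb, Finset.mem_inter, List.mem_toFinset] at hv
      rcases hv with hv | hv
      · exact hm v (Or.inl (hL v hv))
      · exact hm v (Or.inr hv.1)
    · rw [Finset.card_union_of_disjoint]
      · omega
      · rw [Finset.disjoint_left]
        intro v hv hv'
        rw [Finset.mem_inter, List.mem_toFinset] at hv'
        exact (hxp v (mem_nb.1 hv)).2 (hLY v hv'.1)
  rcases hs' with rfl | rfl
  · obtain ⟨L, hL, hLX, hL2⟩ := hXpath a₂ h2.left (Ne.symm haa)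
    obtain ⟨l, hl, hlm⟩ := exists_cyc_of_links hL hLX h1 hL'.reverse
      (fun v hv => hLY v (by simpa using hv)) h2 hd (fun v hv hv' => (hXY v hv hv').elim)
    exact finish hl hL2 (fun v hv => hlm v (by simpa using hv))
  · obtain ⟨L, hL, hLX, hL2⟩ := hXpath a₁ h1.left haa
    obtain ⟨l, hl, hlm⟩ := exists_cyc_of_links hL hLX h2 hL' hLY h1
      (fun v hv hv' => hd v hv' hv) (fun v hv hv' => (hXY v hv hv').elim)
    exact finish hl hL2 hlm

end

section

variable {V : Type*} {G : SimpleGraph V} {k m : ℕ}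

/-- The closest crossing pair of edges from the ends of a longest path, when it misses the wanted
cycle length by as little as possible. -/
structure Tight (G : SimpleGraph V) (f : ℕ → V) (k m t s : ℕ) : Prop where
  right_mem : t ∈ oddIdx G f m (f (2 * m))
  left_mem : s ∈ oddIdx G f m (f 0)
  lt : t < s
  card_eq : t + 1 + (m - s) = 2 * k - 2
  cover : ∀ u < m, u ≤ t ∨ s ≤ u + 1 → u ∈ oddIdx G f m (f (2 * m)) ∨ u + 1 ∈ oddIdx G f m (f 0)

namespace Tight

variable {f : ℕ → V} {t s : ℕ}

lemma cyc (T : Tight G f k m t s) (hf : PathFun G f (2 * m)) :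
    Cyc G (seg f 0 (2 * t + 1) ++ (seg f (2 * s + 1) (2 * m)).reverse) := by
  have h1 := mem_oddIdx.1 T.right_mem
  have h2 := mem_oddIdx.1 T.left_mem
  have h3 := T.lt
  exact hf.cyc_of_cross (by omega) (by omega) h1.2 h2.2

end Tight

lemma mem_oddIdx_rev {f : ℕ → V} {u : ℕ} {x : V} (hu : u < m) :
    u ∈ oddIdx G (fun i => f (2 * m - i)) m x ↔ m - 1 - u ∈ oddIdx G f m x := by
  rw [mem_oddIdx, mem_oddIdx, show 2 * m - (2 * u + 1) = 2 * (m - 1 - u) + 1 by omega]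
  have : m - 1 - u < m := by omega
  tauto

lemma Tight.rev {f : ℕ → V} {t s : ℕ} (T : Tight G f k m t s) (hf : PathFun G f (2 * m)) :
    Tight G (fun i => f (2 * m - i)) k m (m - 1 - s) (m - 1 - t) := by
  have h1 := (mem_oddIdx.1 T.right_mem).1
  have h2 := (mem_oddIdx.1 T.left_mem).1
  have h3 := T.lt
  have h4 := T.card_eq
  refine ⟨?_, ?_, by omega, by omega, fun u hu h => ?_⟩
  · rw [mem_oddIdx_rev (by omega), Nat.sub_self, show m - 1 - (m - 1 - s) = s by omega]
    exact T.left_mem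
  · rw [mem_oddIdx_rev (by omega), Nat.sub_zero, show m - 1 - (m - 1 - t) = t by omega]
    exact T.right_mem
  · rw [mem_oddIdx_rev hu, Nat.sub_self, Nat.sub_zero]
    by_cases hu' : u + 1 = m
    · left
      rw [show m - 1 - u = 0 by omega]
      exact mem_oddIdx.2 ⟨by omega, hf.adj 0 (by omega)⟩
    · rw [mem_oddIdx_rev (by omega)]
      have := T.cover (m - 1 - (u + 1)) (by omega) (by omega)
      rw [show m - 1 - (u + 1) + 1 = m - 1 - u by omega] at this
      exact this.symm

variable [Fintype V] [DecidableEq V] {A : Finset V}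

/-- A balanced graph without the wanted cycle, all of whose paths have at most `2 * m + 1`
vertices. -/
structure Extremal (G : SimpleGraph V) (A : Finset V) (k m : ℕ) : Prop where
  setting : Setting G A k k
  card_eq : A.card = Aᶜ.card
  length_le : ∀ p x y, Pth G p x y → p.length ≤ 2 * m + 1
  not_hasCyc : ¬ HasCyc G (min Aᶜ.card (2 * k - 1))

namespace Extremal

variable {f : ℕ → V} {t s : ℕ}

lemma lock_left (E : Extremal G A k m) (hf : PathFun G f (2 * m)) (w : V) (hw : G.Adj (f 0) w) :
    w ∈ seg f 0 (2 * m) := by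
  by_contra h
  have := E.length_le _ _ _ ((hf.seg_pth (Nat.zero_le _) le_rfl).cons hw.symm h)
  simp only [List.length_cons, length_seg] at this
  omega

lemma lock_right (E : Extremal G A k m) (hf : PathFun G f (2 * m)) (w : V)
    (hw : G.Adj (f (2 * m)) w) : w ∈ seg f 0 (2 * m) := by
  by_contra h
  have := E.length_le _ _ _ ((hf.seg_pth (Nat.zero_le _) le_rfl).concat hw h)
  simp only [List.length_append, List.length_singleton, length_seg] at this
  omega

lemma right_mem_side (E : Extremal G A k m) (hf : PathFun G f (2 * m)) (h0 : f 0 ∈ A) :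
    f (2 * m) ∈ A := (hf.mem_iff E.setting.bip h0 le_rfl).2 (by omega)

lemma succ_notMem (E : Extremal G A k m) (hf : PathFun G f (2 * m)) (h0 : f 0 ∈ A) {u : ℕ}
    (hu : u ∈ oddIdx G f m (f (2 * m))) : u + 1 ∉ oddIdx G f m (f 0) := by
  intro hu'
  rw [mem_oddIdx] at hu hu'
  refine E.not_hasCyc ((E.setting.hasCyc_of_adjacent_cross hf h0 (E.right_mem_side hf h0)
    (E.lock_right hf) (fun p x y h => E.length_le _ _ _ h.path) (i := 2 * u + 1) (by omega)
    hu'.2 hu.2).mono ?_)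
  omega

lemma cross_le (E : Extremal G A k m) (hf : PathFun G f (2 * m)) (h0 : f 0 ∈ A)
    (ht : t ∈ oddIdx G f m (f (2 * m))) (hs : s ∈ oddIdx G f m (f 0)) (hts : t < s) :
    t + 1 + (m - s) ≤ 2 * k - 2 := by
  by_contra h
  exact E.not_hasCyc ((hf.hasCyc_of_cross E.setting.bip h0 hts hs ht).mono (by omega))

lemma exists_tight (E : Extremal G A k m) (hf : PathFun G f (2 * m)) (h0 : f 0 ∈ A) :
    ∃ t s, Tight G f k m t s := by
  have S := E.setting
  have hm := E.right_mem_side hf h0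
  have hk0 := (S.deg_left _ h0).trans (hf.card_nb_le_oddIdx S.bip h0 h0 (E.lock_left hf))
  have hkm := (S.deg_left _ hm).trans (hf.card_nb_le_oddIdx S.bip h0 hm (E.lock_right hf))
  by_cases hcr : ∃ t ∈ oddIdx G f m (f (2 * m)), ∃ s ∈ oddIdx G f m (f 0), t < s
  · obtain ⟨t, ht, s, hs, hts, hle, hcov⟩ := exists_closest_pair
      (fun u hu => (mem_oddIdx.1 hu).1) (fun u hu => (mem_oddIdx.1 hu).1) hk0 hkm
      (fun u hu => E.succ_notMem hf h0 hu) hcr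
    have h := E.cross_le hf h0 ht hs hts
    exact ⟨t, s, ht, hs, hts, by omega, hcov h⟩
  · push Not at hcr
    exact absurd ((hf.hasCyc_of_not_cross S.bip S.conn2 h0 S.two_le_left hk0 hkm hcr).mono
      (min_le_right _ _)) E.not_hasCyc

/-- No closed path contains many vertices `f (2 * u + 1)`. -/
lemma not_cyc (E : Extremal G A k m) (hf : PathFun G f (2 * m)) (h0 : f 0 ∈ A) {l : List V}
    (hl : Cyc G l) (I : Finset ℕ) (hI : ∀ u ∈ I, u < m ∧ f (2 * u + 1) ∈ l) :
    I.card ≤ 2 * k - 2 := by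
  by_contra h
  have hk := E.setting.two_le_left
  refine E.not_hasCyc ((hf.hasCyc E.setting.bip.compl hl (I.image fun u => 2 * u + 1) ?_
    (m := 2 * k - 1) (by omega) ?_).mono (min_le_right _ _))
  · intro i hi
    obtain ⟨u, hu, rfl⟩ := Finset.mem_image.1 hi
    have h1 := hI u hu
    have h2 : 2 * u + 1 ≤ 2 * m := by omega
    refine ⟨h2, ?_, h1.2⟩
    rw [Finset.mem_compl, hf.mem_iff E.setting.bip h0 h2]
    omega
  · rw [Finset.card_image_of_injOn (fun a _ b _ hab => by omega)]
    omega

/-- Vertices off the path are only adjacent to its part between the crossing edges. -/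
lemma outside_adj (E : Extremal G A k m) (hf : PathFun G f (2 * m)) (T : Tight G f k m t s)
    {b : V} (hb : b ∉ seg f 0 (2 * m)) {q : ℕ} (hq : q ≤ m) (hbq : G.Adj (f (2 * q)) b) :
    t + 2 ≤ q ∧ q < s := by
  by_contra hcon
  have hlong : ∀ {p : List V} {x : V}, Pth G p x (f (2 * q)) →
      (∀ v ∈ p, v ∈ seg f 0 (2 * m)) → p.length = 2 * m + 1 → False := by
    intro p x hp hsub hlen
    have := E.length_le _ _ _ (hp.concat hbq fun h => hb (hsub b h))
    simp only [List.length_append, List.length_singleton] at this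
    omega
  have hmono : ∀ {i j : ℕ}, j ≤ 2 * m → ∀ v ∈ seg f i j, v ∈ seg f 0 (2 * m) := by
    intro i j hj v hv
    obtain ⟨u, h1, h2, rfl⟩ := mem_seg.1 hv
    exact apply_mem_seg (Nat.zero_le _) (by omega)
  rcases Nat.eq_zero_or_pos q with rfl | hq0
  · exact hlong (hf.seg_pth (Nat.zero_le _) le_rfl).reverse (by simp)
      (by simp [length_seg])
  rcases hq.eq_or_lt with rfl | hqm
  · exact hlong (hf.seg_pth (Nat.zero_le _) le_rfl) (fun v hv => hv) (by simp [length_seg])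
  have hcov := T.cover (q - 1) (by omega) (by omega)
  rw [show q - 1 + 1 = q by omega, mem_oddIdx, mem_oddIdx,
    show 2 * (q - 1) + 1 = 2 * q - 1 by omega] at hcov
  rcases hcov with h | h
  · refine hlong ((hf.seg_pth (i := 0) (j := 2 * q - 1) (by omega) (by omega)).append
      (hf.seg_pth (i := 2 * q) (j := 2 * m) (by omega) le_rfl).reverse h.2.symm
      (fun v hv hv' => hf.seg_disjoint (i' := 2 * q) (by omega) le_rfl v hv (by simpa using hv')))
      (fun v hv => ?_) ?_
    · rw [List.mem_append, List.mem_reverse] at hv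
      exact hv.elim (hmono (by omega) v) (hmono le_rfl v)
    · simp only [List.length_append, List.length_reverse, length_seg]
      omega
  · refine hlong ((hf.seg_pth (i := 2 * q + 1) (j := 2 * m) (by omega) le_rfl).reverse.append
      (hf.seg_pth (i := 0) (j := 2 * q) (by omega) (by omega)) h.2.symm
      (fun v hv hv' => hf.seg_disjoint (i' := 2 * q + 1) (by omega) le_rfl v hv'
        (by simpa using hv)))
      (fun v hv => ?_) ?_
    · rw [List.mem_append, List.mem_reverse] at hv
      exact hv.elim (hmono le_rfl v) (hmono (by omega) v)
    · simp only [List.length_append, List.length_reverse, length_seg]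
      omega

/-- If the gap is wide, the last vertex has a single neighbour before the gap. -/
lemma notMem_of_lt (E : Extremal G A k m) (hf : PathFun G f (2 * m)) (h0 : f 0 ∈ A)
    (T : Tight G f k m t s) (hgap : 2 * k ≤ m) {j : ℕ} (hjt : j < t) :
    j ∉ oddIdx G f m (f (2 * m)) := by
  intro hj
  have hk := E.setting.two_le_left
  have htm := mem_oddIdx.1 T.right_mem
  have hsm := mem_oddIdx.1 T.left_mem
  have hts := T.lt
  have hce := T.card_eq
  have hfill : ∀ d, j + d < t → j + d ∈ oddIdx G f m (f (2 * m)) := by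
    intro d
    induction d with
    | zero => exact fun _ => hj
    | succ d ih =>
      intro hd
      have h1 := ih (by omega)
      rcases T.cover (j + (d + 1)) (by omega) (by omega) with h | h
      · exact h
      · have h2 := (mem_oddIdx.1 h).1
        have := E.cross_le hf h0 h1 h (by omega)
        omega
  have hpred : t - 1 ∈ oddIdx G f m (f (2 * m)) := by
    have := hfill (t - 1 - j) (by omega)
    rwa [show j + (t - 1 - j) = t - 1 by omega] at this
  have ht0 : t ∉ oddIdx G f m (f 0) := by
    have := E.succ_notMem hf h0 hpred
    rwa [show t - 1 + 1 = t by omega] at this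
  obtain ⟨w, hw0, hwmax⟩ : ∃ w, w ∈ oddIdx G f m (f 0) ∧ ∀ i ∈ oddIdx G f m (f 0), i ≤ w :=
    ⟨_, Finset.max'_mem _ ⟨s, T.left_mem⟩, fun i hi => Finset.le_max' _ _ hi⟩
  have hsw := hwmax s T.left_mem
  have hw0' := mem_oddIdx.1 hw0
  have hwm : w ∈ oddIdx G f m (f (2 * m)) := by
    refine (T.cover w hw0'.1 (by omega)).resolve_right fun h => ?_
    have := hwmax _ h
    omega
  have hwm' := mem_oddIdx.1 hwm
  set g : ℕ → V := fun i => if i ≤ 2 * w + 1 then f i else f (2 * m + 2 * w + 2 - i) with hg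
  have hg1 : ∀ i ≤ 2 * w + 1, g i = f i := fun i hi => by simp [hg, hi]
  have hg2 : ∀ i, 2 * w + 2 ≤ i → g i = f (2 * m + 2 * w + 2 - i) := fun i hi => by
    simp [hg, show ¬ i ≤ 2 * w + 1 by omega]
  have hgp : PathFun G g (2 * m) := by
    refine ⟨fun i hi => ?_, fun i i' hi hi' h => ?_⟩
    · rcases Nat.lt_trichotomy i (2 * w + 1) with h | h | h
      · rw [hg1 i (by omega), hg1 (i + 1) (by omega)]
        exact hf.adj i hi
      · rw [hg1 i (by omega), hg2 (i + 1) (by omega), h,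
          show 2 * m + 2 * w + 2 - (2 * w + 1 + 1) = 2 * m by omega]
        exact hwm'.2.symm
      · rw [hg2 i (by omega), hg2 (i + 1) (by omega)]
        have := hf.adj (2 * m + 2 * w + 2 - (i + 1)) (by omega)
        rw [show 2 * m + 2 * w + 2 - (i + 1) + 1 = 2 * m + 2 * w + 2 - i by omega] at this
        exact this.symm
    · simp only [hg] at h
      split_ifs at h with h1 h2 h2 <;> have := hf.inj _ _ (by omega) (by omega) h <;> omega
  have hg0 : g 0 = f 0 := hg1 0 (by omega)
  have hgm : g (2 * m) = f (2 * w + 2) := by rw [hg2 _ (by omega)]; congr 1; omega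
  have hN0 : ∀ u, u ∈ oddIdx G g m (g 0) → u ∈ oddIdx G f m (f 0) := by
    intro u hu
    rw [mem_oddIdx, hg0] at hu
    by_cases huw : u ≤ w
    · rw [hg1 _ (by omega)] at hu
      exact mem_oddIdx.2 hu
    · rw [hg2 _ (by omega),
        show 2 * m + 2 * w + 2 - (2 * u + 1) = 2 * (m + w - u) + 1 by omega] at hu
      have := hwmax (m + w - u) (mem_oddIdx.2 ⟨by omega, hu.2⟩)
      omega
  obtain ⟨t', s', T'⟩ := E.exists_tight hgp (by rwa [hg0])
  have hs' := hN0 s' T'.left_mem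
  have hs'm := (mem_oddIdx.1 hs').1
  have hts' := T'.lt
  have hce' := T'.card_eq
  have hadj : G.Adj (f (2 * w + 2)) (f (2 * t - 1)) := by
    have hor : t - 1 ≤ t' ∨ s' ≤ t - 1 + 1 := by
      by_contra! h
      have := E.cross_le hf h0 T.right_mem hs' (by omega)
      omega
    rcases T'.cover (t - 1) (by omega) hor with h | h
    · rw [mem_oddIdx, hgm, hg1 _ (by omega), show 2 * (t - 1) + 1 = 2 * t - 1 by omega] at h
      exact h.2
    · rw [show t - 1 + 1 = t by omega] at h
      exact absurd (hN0 t h) ht0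
  have hcyc : Cyc G ((seg f 0 (2 * t - 1) ++ seg f (2 * w + 2) (2 * m)) ++
      seg f (2 * t + 1) (2 * w + 1)) := by
    refine ⟨_, _, ((hf.seg_pth (by omega) (by omega)).append (hf.seg_pth (by omega) le_rfl)
      hadj.symm (hf.seg_disjoint (by omega) le_rfl)).append
      (hf.seg_pth (i := 2 * t + 1) (j := 2 * w + 1) (by omega) (by omega)) htm.2 ?_, hw0'.2.symm⟩
    intro v hv hv'
    rcases List.mem_append.1 hv with hv | hv
    · exact hf.seg_disjoint (by omega) (by omega) v hv hv'
    · exact hf.seg_disjoint (by omega) le_rfl v hv' hv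
  have := E.not_cyc hf h0 hcyc (Finset.range m) (by
    intro u hu
    rw [Finset.mem_range] at hu
    refine ⟨hu, ?_⟩
    rw [List.mem_append, List.mem_append]
    by_cases h1 : u < t
    · exact Or.inl (Or.inl (apply_mem_seg (by omega) (by omega)))
    by_cases h2 : w < u
    · exact Or.inl (Or.inr (apply_mem_seg (by omega) (by omega)))
    · exact Or.inr (apply_mem_seg (by omega) (by omega)))
  rw [Finset.card_range] at this
  omega

/-- If the gap is wide, no vertex in it is adjacent to a vertex before it. -/
lemma not_adj_gap (E : Extremal G A k m) (hf : PathFun G f (2 * m)) (h0 : f 0 ∈ A)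
    (T : Tight G f k m t s) (hgap : 2 * k ≤ m) {q u : ℕ} (hq : q ≤ t) (htu : t < u) (hus : u < s) :
    ¬ G.Adj (f (2 * q)) (f (2 * u + 1)) := by
  intro hadj
  have hk := E.setting.two_le_left
  have htm := mem_oddIdx.1 T.right_mem
  have hsm := mem_oddIdx.1 T.left_mem
  have hce := T.card_eq
  rcases Nat.eq_zero_or_pos q with rfl | hq0
  · have := E.cross_le hf h0 T.right_mem (mem_oddIdx.2 ⟨by omega, hadj⟩) htu
    omega
  rcases T.cover (q - 1) (by omega) (by omega) with h | h
  · exact E.notMem_of_lt hf h0 T hgap (by omega) h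
  rw [show q - 1 + 1 = q by omega, mem_oddIdx] at h
  have hcyc : Cyc G (((seg f 0 (2 * q)).reverse ++ seg f (2 * q + 1) (2 * t + 1)) ++
      (seg f (2 * u + 1) (2 * m)).reverse) := by
    refine ⟨_, _, ((hf.seg_pth (by omega) (by omega)).reverse.append
      (hf.seg_pth (by omega) (by omega)) h.2 fun v hv hv' => ?_).append
      (hf.seg_pth (by omega) le_rfl).reverse htm.2.symm fun v hv hv' => ?_, hadj.symm⟩
    · exact hf.seg_disjoint (by omega) (by omega) v (List.mem_reverse.1 hv) hv'
    · rw [List.mem_reverse] at hv'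
      rcases List.mem_append.1 hv with hv | hv
      · exact hf.seg_disjoint (by omega) le_rfl v (List.mem_reverse.1 hv) hv'
      · exact hf.seg_disjoint (by omega) le_rfl v hv hv'
  have := E.not_cyc hf h0 hcyc (Finset.range (t + 1) ∪ Finset.Ico u m) (by
    intro i hi
    rw [Finset.mem_union, Finset.mem_range, Finset.mem_Ico] at hi
    refine ⟨by omega, ?_⟩
    rw [List.mem_append, List.mem_append, List.mem_reverse, List.mem_reverse]
    by_cases h1 : u ≤ i
    · exact Or.inr (apply_mem_seg (by omega) (by omega))
    by_cases h2 : i < q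
    · exact Or.inl (Or.inl (apply_mem_seg (by omega) (by omega)))
    · exact Or.inl (Or.inr (apply_mem_seg (by omega) (by omega))))
  rw [Finset.card_union_of_disjoint, Finset.card_range, Nat.card_Ico] at this
  · omega
  · rw [Finset.disjoint_left]
    intro i
    simp only [Finset.mem_range, Finset.mem_Ico]
    omega

end Extremal

end

section

variable {V : Type*} {G : SimpleGraph V}

lemma PathFun.mem_cross_iff {f : ℕ → V} {m t s : ℕ} (hf : PathFun G f (2 * m)) (htm : t < m) {i : ℕ}
    (hi : i ≤ 2 * m) :
    f i ∈ seg f 0 (2 * t + 1) ++ (seg f (2 * s + 1) (2 * m)).reverse ↔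
      i ≤ 2 * t + 1 ∨ 2 * s + 1 ≤ i := by
  refine ⟨fun h => ?_, PathFun.mem_cross hi⟩
  rw [List.mem_append, List.mem_reverse, mem_seg, mem_seg] at h
  rcases h with ⟨u, h1, h2, h3⟩ | ⟨u, h1, h2, h3⟩
  · have := hf.inj _ _ (by omega) hi h3
    omega
  · have := hf.inj _ _ (by omega) hi h3
    omega

variable [Fintype V] [DecidableEq V] {A : Finset V} {k m : ℕ}

namespace Extremal

variable {f : ℕ → V} {t s : ℕ}

lemma false_of_tail (E : Extremal G A k m) (hf : PathFun G f (2 * m)) (T : Tight G f k m t s)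
    {p : List V} {x c : V} (hp : Pth G p x c)
    (hc : c ∈ seg f 0 (2 * t + 1) ++ (seg f (2 * s + 1) (2 * m)).reverse)
    (hpC : ∀ v ∈ p, v ∈ seg f 0 (2 * t + 1) ++ (seg f (2 * s + 1) (2 * m)).reverse → v = c)
    (hx : x ∉ A) (hxp : ∀ v, G.Adj x v →
      v ∈ p ∧ v ∉ seg f 0 (2 * t + 1) ++ (seg f (2 * s + 1) (2 * m)).reverse) : False := by
  have S := E.setting
  have h := T.card_eq
  have h1 := (mem_oddIdx.1 T.left_mem).1
  refine E.not_hasCyc ((hasCyc_of_tail S.bip S.conn2 S.two_le_left (T.cyc hf) ?_ hp hc hpC hx hxp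
    (S.deg_right x hx)).mono (min_le_right _ _))
  simp only [List.length_append, List.length_reverse, length_seg]
  omega

lemma false_of_wide (E : Extremal G A k m) (hf : PathFun G f (2 * m)) (h0 : f 0 ∈ A)
    (T : Tight G f k m t s) (hgap : 2 * k ≤ m) : False := by
  have S := E.setting
  have hts := T.lt
  have htm := (mem_oddIdx.1 T.right_mem).1
  have hsm := (mem_oddIdx.1 T.left_mem).1
  have hce := T.card_eq
  have hC := T.cyc hf
  have hmemC : ∀ i ≤ 2 * m, f i ∈ seg f 0 (2 * t + 1) ++ (seg f (2 * s + 1) (2 * m)).reverse ↔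
      i ≤ 2 * t + 1 ∨ 2 * s + 1 ≤ i := fun i hi => hf.mem_cross_iff htm hi
  have hCP : ∀ v ∈ seg f 0 (2 * t + 1) ++ (seg f (2 * s + 1) (2 * m)).reverse,
      ∃ i ≤ 2 * m, f i = v := by
    intro v hv
    rw [List.mem_append, List.mem_reverse, mem_seg, mem_seg] at hv
    rcases hv with ⟨u, h1, h2, h3⟩ | ⟨u, h1, h2, h3⟩
    · exact ⟨u, by omega, h3⟩
    · exact ⟨u, by omega, h3⟩
  set C := seg f 0 (2 * t + 1) ++ (seg f (2 * s + 1) (2 * m)).reverse with hCdef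
  obtain ⟨a₀, b₀, hp₀, -⟩ := id hC
  have hsep : ∀ b ∉ C, b ∉ A → ∀ c ∈ C, ¬ G.Adj c b := by
    intro b hb hbA c hc hcb
    obtain ⟨i, hi, rfl⟩ := hCP c hc
    have hiC := (hmemC i hi).1 hc
    have hiA := (hf.mem_iff S.bip h0 hi).1 ((S.bip _ _ hcb).2 hbA)
    obtain ⟨q, rfl⟩ : ∃ q, i = 2 * q := ⟨i / 2, by omega⟩
    by_cases hbP : b ∈ seg f 0 (2 * m)
    · obtain ⟨j, -, hj, rfl⟩ := mem_seg.1 hbP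
      rw [hf.mem_iff S.bip h0 hj] at hbA
      rw [hmemC j hj] at hb
      obtain ⟨u, rfl⟩ : ∃ u, j = 2 * u + 1 := ⟨j / 2, by omega⟩
      rcases hiC with hq | hq
      · exact E.not_adj_gap hf h0 T hgap (by omega) (by omega) (by omega) hcb
      · refine E.not_adj_gap hf.rev (E.right_mem_side hf h0) (T.rev hf) hgap (q := m - q)
          (u := m - 1 - u) (by omega) (by omega) (by omega) ?_
        rw [show 2 * m - 2 * (m - q) = 2 * q by omega,
          show 2 * m - (2 * (m - 1 - u) + 1) = 2 * u + 1 by omega]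
        exact hcb
    · have := E.outside_adj hf T hbP (q := q) (by omega) hcb
      omega
  classical
  have hout := S.card_outside hC
  have heq := E.card_eq
  have h1 : (Finset.univ \ C.toFinset) \ Aᶜ = (Finset.univ \ C.toFinset) ∩ A := by ext v; simp
  have h2 : (Finset.univ \ C.toFinset) ∩ Aᶜ = (Finset.univ \ C.toFinset) \ A := by ext v; simp
  set R : Finset V := Finset.univ.filter fun r => ∃ c ∈ C, G.Adj c r with hR
  obtain ⟨q, z, x, hz, hq, hx, hqW, hlock⟩ := exists_locked_in S.bip.compl _
    (Finset.univ \ C.toFinset) R rfl (by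
      intro w hw
      obtain ⟨r, c, hc, p, hcr, hp, hpC⟩ := S.exists_pth_to hp₀.ne_nil (w := w) (by simpa using hw)
      exact ⟨r, by simpa [hR] using ⟨c, hc, hcr⟩, _, hp.reverse,
        fun v hv => by simpa using hpC v (by simpa using hv)⟩)
    (Or.inr ⟨by rw [h1, h2]; omega, f (2 * t + 2), by
      simpa [hR] using ⟨_, (hmemC (2 * t + 1) (by omega)).2 (by omega), hf.adj _ (by omega)⟩, by
      have : f (2 * t + 2) ∉ C := by rw [hmemC _ (by omega)]; omega
      simpa using this, by
      have := (hf.mem_iff S.bip h0 (i := 2 * t + 2) (by omega)).2 (by omega)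
      simpa using this⟩)
  have hqC : ∀ v ∈ q, v ∉ C := fun v hv => by simpa using hqW v hv
  obtain ⟨c, hc, hcz⟩ := (Finset.mem_filter.1 hz).2
  rw [Finset.mem_compl] at hx
  have hxC := hqC x hq.last_mem
  refine E.false_of_tail hf T (hq.reverse.concat hcz.symm fun h => hqC c
    (by simpa using h) hc) hc ?_ hx ?_
  · intro v hv hvC
    rw [List.mem_append, List.mem_reverse, List.mem_singleton] at hv
    exact hv.resolve_left fun h => hqC v h hvC
  · intro v hv
    have hvC : v ∉ C := fun h => hsep x hxC hx v h hv.symm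
    exact ⟨List.mem_append_left _ (List.mem_reverse.2 (hlock v (by simpa using hvC) hv)), hvC⟩

lemma false_of_narrow (E : Extremal G A k m) (hf : PathFun G f (2 * m)) (h0 : f 0 ∈ A)
    (T : Tight G f k m t s) (hst : s = t + 2) : False := by
  have S := E.setting
  have htm := (mem_oddIdx.1 T.right_mem).1
  have hsm := (mem_oddIdx.1 T.left_mem).1
  have hmemC : ∀ i ≤ 2 * m, f i ∈ seg f 0 (2 * t + 1) ++ (seg f (2 * s + 1) (2 * m)).reverse ↔
      i ≤ 2 * t + 1 ∨ 2 * s + 1 ≤ i := fun i hi => hf.mem_cross_iff htm hi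
  have hCP : ∀ v ∈ seg f 0 (2 * t + 1) ++ (seg f (2 * s + 1) (2 * m)).reverse,
      v ∈ seg f 0 (2 * m) := by
    intro v hv
    rw [List.mem_append, List.mem_reverse, mem_seg, mem_seg] at hv
    rcases hv with ⟨u, h1, h2, rfl⟩ | ⟨u, h1, h2, rfl⟩
    · exact apply_mem_seg (by omega) (by omega)
    · exact apply_mem_seg (by omega) (by omega)
  set C := seg f 0 (2 * t + 1) ++ (seg f (2 * s + 1) (2 * m)).reverse with hCdef
  set P := seg f 0 (2 * m) with hPdef
  have hP : Pth G P (f 0) (f (2 * m)) := hf.seg_pth (Nat.zero_le _) le_rfl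
  have hsep : ∀ b ∉ P, b ∉ A → ∀ c ∈ P, ¬ G.Adj c b := by
    intro b hb hbA c hc hcb
    obtain ⟨i, -, hi, rfl⟩ := mem_seg.1 hc
    have hiA := (hf.mem_iff S.bip h0 hi).1 ((S.bip _ _ hcb).2 hbA)
    obtain ⟨q, rfl⟩ : ∃ q, i = 2 * q := ⟨i / 2, by omega⟩
    have := E.outside_adj hf T hb (q := q) (by omega) hcb
    omega
  classical
  have heq := E.card_eq
  have hcount : ((Finset.univ \ P.toFinset) \ Aᶜ).card <
      ((Finset.univ \ P.toFinset) ∩ Aᶜ).card := by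
    have h1 : ((Finset.univ \ P.toFinset) \ Aᶜ).card + (P.toFinset ∩ A).card = A.card := by
      rw [← Finset.card_union_of_disjoint]
      · congr 1; ext v; simp only [Finset.mem_union, Finset.mem_inter, Finset.mem_sdiff,
          Finset.mem_univ, true_and, Finset.mem_compl]; tauto
      · rw [Finset.disjoint_left]; intro v; simp only [Finset.mem_inter, Finset.mem_sdiff,
          Finset.mem_univ, true_and]; tauto
    have h2 : ((Finset.univ \ P.toFinset) ∩ Aᶜ).card + (P.toFinset \ A).card = Aᶜ.card := by
      rw [← Finset.card_union_of_disjoint]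
      · congr 1; ext v; simp only [Finset.mem_union, Finset.mem_sdiff, Finset.mem_compl,
          Finset.mem_inter, Finset.mem_univ, true_and]; tauto
      · rw [Finset.disjoint_left]; intro v; simp only [Finset.mem_sdiff, Finset.mem_inter,
          Finset.mem_univ, true_and]; tauto
    have h3 : (P.toFinset ∩ A).card + (P.toFinset \ A).card = P.length := by
      rw [Finset.card_inter_add_card_sdiff, List.toFinset_card_of_nodup hP.nodup]
    have h4 := hP.count S.bip
    rw [if_pos h0, if_pos (E.right_mem_side hf h0)] at h4
    have h5 : (P.filter (· ∈ A)).length = (P.toFinset ∩ A).card := by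
      rw [← List.toFinset_card_of_nodup (hP.nodup.filter _)]
      congr 1
      ext v
      simp
    omega
  set R : Finset V := Finset.univ.filter fun r => ∃ c ∈ P, G.Adj c r with hR
  obtain ⟨q, z, x, hz, hq, hx, hqW, hlock⟩ := exists_locked_in S.bip.compl _
    (Finset.univ \ P.toFinset) R rfl (by
      intro w hw
      obtain ⟨r, c, hc, p, hcr, hp, hpC⟩ := S.exists_pth_to hP.ne_nil (w := w) (by simpa using hw)
      exact ⟨r, by simpa [hR] using ⟨c, hc, hcr⟩, _, hp.reverse,
        fun v hv => by simpa using hpC v (by simpa using hv)⟩) (Or.inl hcount)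
  have hqP : ∀ v ∈ q, v ∉ P := fun v hv => by simpa using hqW v hv
  obtain ⟨c, hc, hcz⟩ := (Finset.mem_filter.1 hz).2
  rw [Finset.mem_compl] at hx
  have hxP := hqP x hq.last_mem
  obtain ⟨i, -, hi, rfl⟩ := mem_seg.1 hc
  obtain ⟨r, i', hr, hi', hrP, hrC⟩ : ∃ r i', Pth G r (f i) (f i') ∧ f i' ∈ C ∧ (∀ v ∈ r, v ∈ P) ∧
      ∀ v ∈ r, v ∈ C → v = f i' := by
    by_cases hiC : f i ∈ C
    · exact ⟨_, i, Pth.singleton _, hiC, by simpa using hc, by simp⟩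
    · have hiC' := hiC
      rw [hmemC i hi] at hiC'
      refine ⟨_, _, (hf.seg_pth (i := 2 * t + 1) (by omega) hi).reverse,
        (hmemC _ (by omega)).2 (by omega), fun v hv => ?_, fun v hv hvC => ?_⟩
      · obtain ⟨u, h1, h2, rfl⟩ := mem_seg.1 (List.mem_reverse.1 hv)
        exact apply_mem_seg (by omega) (by omega)
      · obtain ⟨u, h1, h2, rfl⟩ := mem_seg.1 (List.mem_reverse.1 hv)
        rw [hmemC u (by omega)] at hvC
        congr 1
        omega
  refine E.false_of_tail hf T (hq.reverse.append hr hcz.symm fun v hv hv' =>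
    hqP v (List.mem_reverse.1 hv) (hrP v hv')) hi' ?_ hx ?_
  · intro v hv hvC
    rw [List.mem_append, List.mem_reverse] at hv
    exact hrC v (hv.resolve_left fun h => hqP v h (hCP v hvC)) hvC
  · intro v hv
    have hvP : v ∉ P := fun h => hsep x hxP hx v h hv.symm
    exact ⟨List.mem_append_left _ (List.mem_reverse.2 (hlock v (by simpa using hvP) hv)),
      fun h => hvP (hCP v h)⟩

theorem false_of_path (E : Extremal G A k m) (hf : PathFun G f (2 * m)) (h0 : f 0 ∈ A) : False := by
  obtain ⟨t, s, T⟩ := E.exists_tight hf h0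
  have hts := T.lt
  have hsm := (mem_oddIdx.1 T.left_mem).1
  have hce := T.card_eq
  have hk := E.setting.two_le_left
  have hne : s ≠ t + 1 := fun h => E.succ_notMem hf h0 T.right_mem (h ▸ T.left_mem)
  by_cases hgap : 2 * k ≤ m
  · exact E.false_of_wide hf h0 T hgap
  · exact E.false_of_narrow hf h0 T (by omega)

end Extremal

namespace Setting

lemma compl (S : Setting G A k k) (hcard : A.card = Aᶜ.card) : Setting G Aᶜ k k where
  bip := S.bip.compl
  conn2 := S.conn2
  conn := S.conn
  card_le := by rw [compl_compl]; exact hcard.le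
  two_le_left := S.two_le_left
  two_le_right := S.two_le_left
  deg_left a ha := S.deg_right a (by simpa using ha)
  deg_right b hb := S.deg_left b (by simpa using hb)

lemma hasCyc_of_longest (S : Setting G A k k) (hcard : A.card = Aᶜ.card) {p : List V} {x y : V}
    (hp : Pth G p x y) (hmax : ∀ p' x' y', Pth G p' x' y' → p'.length ≤ p.length) (hx : x ∈ A) :
    HasCyc G (min Aᶜ.card (2 * k - 1)) := by
  have hxlock : ∀ v, G.Adj x v → v ∈ p := by
    intro v hv
    by_contra hvp
    have := hmax _ _ _ (hp.cons hv.symm hvp)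
    simp at this
  have hylock : ∀ v, G.Adj y v → v ∈ p := by
    intro v hv
    by_contra hvp
    have := hmax _ _ _ (hp.concat hv hvp)
    simp at this
  by_cases hy : y ∈ A
  swap
  · exact (S.hasCyc_of_locked_opposite ⟨hp, hx, hxlock⟩ hy hylock
      (fun p' x' y' h => hmax _ _ _ h.path)).mono (by omega)
  obtain ⟨f, n, hf, rfl, rfl, hlen, rfl⟩ := hp.exists_pathFun
  obtain ⟨m, rfl⟩ : ∃ m, n = 2 * m := by
    have := (hf.mem_iff S.bip hx le_rfl).1 hy
    exact ⟨n / 2, by omega⟩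
  by_contra hno
  exact Extremal.false_of_path ⟨S, hcard, hlen ▸ hmax, hno⟩ hf hx

/-- The bound on the circumference for balanced graphs. -/
theorem hasCyc_min_of_balanced (S : Setting G A k k) (hcard : A.card = Aᶜ.card) [Nonempty V] :
    HasCyc G (min Aᶜ.card (2 * k - 1)) := by
  obtain ⟨p, ⟨x, y, hp⟩, hmax⟩ := exists_longest (P := fun p => ∃ x y, Pth G p x y)
    (fun p hp => hp.choose_spec.choose_spec.nodup)
    ⟨_, Classical.arbitrary V, _, Pth.singleton _⟩
  have hmax' : ∀ p' x' y', Pth G p' x' y' → p'.length ≤ p.length :=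
    fun p' x' y' h => hmax p' ⟨x', y', h⟩
  by_cases hx : x ∈ A
  · exact S.hasCyc_of_longest hcard hp hmax' hx
  · have := (S.compl hcard).hasCyc_of_longest (by rw [compl_compl]; exact hcard.symm) hp hmax'
      (by simpa using hx)
    rwa [compl_compl, hcard] at this

end Setting

lemma Conn2.two_le_card_nb (hG : Conn2 G) (hV : 2 < Fintype.card V) (a : V) :
    2 ≤ (nb G a).card := by
  have key : ∀ w, w ≠ a → ∃ w', w' ≠ w ∧ w' ∈ nb G a := by
    intro w hw
    obtain ⟨d, -, hd⟩ := Finset.exists_mem_notMem_of_card_lt_card (s := {a, w})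
      (t := (Finset.univ : Finset V))
      (by rw [Finset.card_univ]; exact Finset.card_le_two.trans_lt hV)
    simp only [Finset.mem_insert, Finset.mem_singleton, not_or] at hd
    obtain ⟨p, hp, hwp⟩ := hG w a d (Ne.symm hw) hd.2
    obtain ⟨p', c, hpe, hp', hca, -⟩ := hp.reverse.exists_pred hd.1
    refine ⟨c, fun h => hwp ?_, mem_nb.2 hca.symm⟩
    rw [← List.mem_reverse, hpe]
    exact List.mem_append_left _ (h ▸ hp'.last_mem)
  obtain ⟨v, hv⟩ : ∃ v, v ≠ a := by
    have : Nontrivial V := Fintype.one_lt_card_iff_nontrivial.1 (by omega)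
    exact exists_ne a
  obtain ⟨w, -, hw⟩ := key v hv
  obtain ⟨w', hne, hw'⟩ := key w (mem_nb.1 hw).ne'
  exact Finset.one_lt_card.2 ⟨w', hw', w, hw, hne⟩

end

/-- A 2-connected graph in the sense of vertex removal has paths avoiding any given vertex. -/
lemma conn2_of_kConnected {V : Type*} {G : SimpleGraph V} (h : KConnected 2 G) : Conn2 G := by
  classical
  intro v a b ha hb
  obtain ⟨w, hw⟩ := ((h.2 {v} (Set.finite_singleton v) (by simp)).preconnected ⟨a, ha⟩
    ⟨b, hb⟩).exists_isPath
  have hmap : (w.map (SimpleGraph.Embedding.induce (G := G) ({v}ᶜ : Set V)).toHom).IsPath :=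
    hw.map (SimpleGraph.Embedding.induce (G := G) ({v}ᶜ : Set V)).injective
  refine ⟨_, ⟨SimpleGraph.Walk.isChain_adj_support _, hmap.support_nodup, ?_, ?_⟩, fun hv => ?_⟩
  · rw [List.head?_eq_some_head (SimpleGraph.Walk.support_ne_nil _), SimpleGraph.Walk.head_support]
    rfl
  · rw [List.getLast?_eq_some_getLast (SimpleGraph.Walk.support_ne_nil _),
      SimpleGraph.Walk.getLast_support]
    rfl
  · rw [SimpleGraph.Walk.support_map, List.mem_map] at hv
    obtain ⟨u, -, hu⟩ := hv
    exact u.2 hu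

lemma card_nb_eq_deg {V : Type*} [Fintype V] (G : SimpleGraph V) (v : V) :
    (nb G v).card = deg G v := by
  classical
  rw [deg, ← SimpleGraph.card_neighborFinset_eq_degree]
  congr 1
  ext w
  rw [mem_nb, SimpleGraph.mem_neighborFinset]

lemma Setting.of_kConnected {V : Type*} [Fintype V] [DecidableEq V] {G : SimpleGraph V}
    {A : Finset V} {k l : ℕ} (hA : Bip G A) (h2conn : KConnected 2 G) (hle : Aᶜ.card ≤ A.card)
    (hdegA : ∀ a ∈ A, k ≤ deg G a) (hdegB : ∀ b ∉ A, l ≤ deg G b) :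
    Setting G A (max k 2) (max l 2) where
  bip := hA
  conn2 := conn2_of_kConnected h2conn
  conn := (conn2_of_kConnected h2conn).exists_pth h2conn.1
  card_le := hle
  two_le_left := le_max_right _ _
  two_le_right := le_max_right _ _
  deg_left a ha := max_le (card_nb_eq_deg G a ▸ hdegA a ha)
    ((conn2_of_kConnected h2conn).two_le_card_nb (Nat.card_eq_fintype_card (α := V) ▸ h2conn.1) a)
  deg_right b hb := max_le (card_nb_eq_deg G b ▸ hdegB b hb)
    ((conn2_of_kConnected h2conn).two_le_card_nb (Nat.card_eq_fintype_card (α := V) ▸ h2conn.1) b)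

end BipartiteCycle

theorem stmt8 (V : Type) [Fintype V] [DecidableEq V] (G : SimpleGraph V)
    (A B : Finset V) (k l : ℕ)
    (hdisj : Disjoint A B) (hunion : A ∪ B = Finset.univ)
    (hA : ∀ u ∈ A, ∀ v ∈ A, ¬G.Adj u v) (hB : ∀ u ∈ B, ∀ v ∈ B, ¬G.Adj u v)
    (h2conn : KConnected 2 G) (hBA : B.card ≤ A.card)
    (hdegA : ∀ a ∈ A, k ≤ deg G a) (hdegB : ∀ b ∈ B, l ≤ deg G b) :
    (∃ (v : V) (w : G.Walk v v), w.IsCycle ∧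
      2 * min B.card (min (k + l - 1) (2 * k - 2)) ≤ w.length) ∧
    (k = l → A.card = B.card → ∃ (v : V) (w : G.Walk v v), w.IsCycle ∧
      2 * min B.card (2 * k - 1) ≤ w.length) := by
  obtain rfl : B = Aᶜ := by
    ext v
    have h1 : v ∈ A → v ∉ B := fun h => Finset.disjoint_left.1 hdisj h
    have h2 : v ∈ A ∪ B := hunion ▸ Finset.mem_univ v
    rw [Finset.mem_union] at h2
    rw [Finset.mem_compl]
    tauto
  have hbip : BipartiteCycle.Bip G A := fun u v huv => by
    have h1 := hA u
    have h2 := hB u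
    simp only [Finset.mem_compl] at h2
    by_cases hu : u ∈ A <;> by_cases hv : v ∈ A <;> simp only [hu, hv, not_true, not_false_eq_true]
    · exact absurd huv (h1 hu v hv)
    · exact absurd huv (h2 hu v hv)
  have S := BipartiteCycle.Setting.of_kConnected hbip h2conn hBA hdegA
    (fun b hb => hdegB b (by simpa using hb))
  have : Nonempty V := (Nat.card_pos_iff.1 (by have := h2conn.1; omega)).1
  refine ⟨S.hasCyc_min.mono (by omega), fun hkl hcard => ?_⟩
  subst hkl
  exact (S.hasCyc_min_of_balanced hcard).mono (by omega)
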